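/- Let φ : S³ → ℝ be smooth (i.e. the 0-homogeneous extension y ↦ φ(y/‖y‖) is smooth on ℝ⁴ \ {0}). Then there exists u ∈ C^∞(B⁴) (smooth up to the boundary of the closed unit ball) such that Δ²u = 0 in the open ball, P₃^{S³}u = 0 on S³, and μ u = φ on S³. Any such u is constant on S³, and subject to the condition u|_{S³} = 0 it is unique. Moreover, every such u with u|_{S³} = 0 satisfies sup_{B⁴}|u| ≤ sup_{S³}|φ|. -/

import Mathlib

noncomputable section

open Real Set
open scoped RealInnerProductSpace Topology

abbrev E4 := EuclideanSpace ℝ (Fin 4)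

def e4 (i : Fin 4) : E4 := EuclideanSpace.single i 1

/-- Euclidean Laplacian on `ℝ⁴`. -/
def lap (u : E4 → ℝ) (x : E4) : ℝ :=
  ∑ i : Fin 4, fderiv ℝ (fun y => fderiv ℝ u y (e4 i)) x (e4 i)

/-- Laplacian in the first three variables. -/
def lap3 (u : E4 → ℝ) (x : E4) : ℝ :=
  ∑ i : Fin 3, fderiv ℝ (fun y => fderiv ℝ u y (e4 i.castSucc)) x (e4 i.castSucc)

/-- Spherical Laplacian of (the restriction to `S³` of) `f`, via the `0`-homogeneous
extension `y ↦ f (y / ‖y‖)`. -/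
def sphLap (f : E4 → ℝ) (x : E4) : ℝ := lap (fun y => f (‖y‖⁻¹ • y)) x

/-- Inward normal derivative at a point of the unit sphere: `μ_M u x = -⟨∇u x, x⟩`. -/
def muM (u : E4 → ℝ) (x : E4) : ℝ := -(fderiv ℝ u x x)

/-- Inward normal derivative at a point of the flat boundary `B³ ⊂ {x₄ = 0}`. -/
def muN (u : E4 → ℝ) (x : E4) : ℝ := fderiv ℝ u x (e4 3)

/-- At `p ∈ Σ`, `ν_M f p = -(d/dφ)|_{φ = π/2} f(sin φ • σ, cos φ)`. -/
def nuM (f : E4 → ℝ) (p : E4) : ℝ :=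
  -(deriv (fun t : ℝ => f (Real.sin t • p + Real.cos t • e4 3)) (π/2))

/-- At `p ∈ Σ`, `ν_N f p = -(d/dr)|_{r = 1} f (r • p)`. -/
def nuN (f : E4 → ℝ) (p : E4) : ℝ := -(deriv (fun r : ℝ => f (r • p)) 1)

/-- The closed upper half-ball `B⁴₊`. -/
def B4p : Set E4 := {x | ‖x‖ ≤ 1 ∧ 0 ≤ x 3}
/-- The upper half-sphere `M = S³₊`. -/
def Mhs : Set E4 := {x | ‖x‖ = 1 ∧ 0 ≤ x 3}
/-- The flat boundary `N = B³`. -/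
def Nfb : Set E4 := {x | ‖x‖ ≤ 1 ∧ x 3 = 0}
/-- The corner `Σ = S²`. -/
def Sig : Set E4 := {x | ‖x‖ = 1 ∧ x 3 = 0}

/-- `P₃^M u = (1/2) μ_M (Δu) + Δ_{S³}(μ_M u) - Δ_{S³}(u|_M)`. -/
def P3M (u : E4 → ℝ) (x : E4) : ℝ :=
  (1/2) * muM (lap u) x + sphLap (muM u) x - sphLap u x

/-- `P₃^N u = (1/2) μ_N (Δu) + Δ_{ℝ³}(μ_N u)`. -/
def P3N (u : E4 → ℝ) (x : E4) : ℝ :=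
  (1/2) * muN (lap u) x + lap3 (muN u) x


/-- A solution of the boundary value problem on the whole ball `B⁴`:
`u` smooth up to the boundary (encoded, via Whitney–Seeley extension, as globally smooth),
biharmonic in the open ball, `P₃^{S³} u = 0` and `μ u = φ` on `S³`.  (Here `P3M` is
exactly the operator `P₃^{S³} u = (1/2)μ(Δu) + Δ_{S³}(μ u) - Δ_{S³}(u|_{S³})` and
`muM` is the inward normal derivative `μ`.) -/
def SolBall (φ u : E4 → ℝ) : Prop :=
  ContDiff ℝ (⊤ : ℕ∞) u ∧
  (∀ x : E4, ‖x‖ < 1 → lap (lap u) x = 0) ∧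
  (∀ x : E4, ‖x‖ = 1 → P3M u x = 0) ∧
  (∀ x : E4, ‖x‖ = 1 → muM u x = φ x)

open scoped ContDiff

/-- The `i`-th partial derivative. -/
def pd (i : Fin 4) (f : E4 → ℝ) : E4 → ℝ := fun x => fderiv ℝ f x (e4 i)

/-- The Euler field `x · ∇` acting on functions. -/
def eul (f : E4 → ℝ) : E4 → ℝ := fun x => fderiv ℝ f x x

/-- The defining function `1 - ‖x‖²` of the unit ball. -/
def rho : E4 → ℝ := fun x => 1 - ‖x‖ ^ 2

lemma eq_sum_e4 (x : E4) : x = ∑ i, x i • e4 i := by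
  ext j
  simp [e4, Pi.single_apply]

lemma lap_eq_sum (f : E4 → ℝ) (x : E4) : lap f x = ∑ i, pd i (pd i f) x := rfl

lemma eul_eq_sum (f : E4 → ℝ) (x : E4) : eul f x = ∑ i, x i * pd i f x := by
  conv_lhs => rw [eul]; arg 2; rw [eq_sum_e4 x]
  simp [pd]

lemma ContDiff.pd {f : E4 → ℝ} (hf : ContDiff ℝ ∞ f) (i : Fin 4) : ContDiff ℝ ∞ (pd i f) :=
  (hf.fderiv_right (m := ∞) (by simp)).clm_apply contDiff_const

lemma ContDiff.eul {f : E4 → ℝ} (hf : ContDiff ℝ ∞ f) : ContDiff ℝ ∞ (eul f) :=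
  (hf.fderiv_right (m := ∞) (by simp)).clm_apply contDiff_id

lemma ContDiff.lap {f : E4 → ℝ} (hf : ContDiff ℝ ∞ f) : ContDiff ℝ ∞ (lap f) :=
  ContDiff.sum fun i _ => (hf.pd i).pd i

lemma contDiff_rho : ContDiff ℝ ∞ rho := contDiff_const.sub (contDiff_norm_sq ℝ)

lemma ContDiff.diffAt {f : E4 → ℝ} (hf : ContDiff ℝ ∞ f) (x : E4) : DifferentiableAt ℝ f x :=
  hf.differentiable (by simp) x

lemma ContDiff.cadd {f g : E4 → ℝ} (hf : ContDiff ℝ ∞ f) (hg : ContDiff ℝ ∞ g) :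
    ContDiff ℝ ∞ (f + g) := hf.add hg

lemma ContDiff.cmul {f g : E4 → ℝ} (hf : ContDiff ℝ ∞ f) (hg : ContDiff ℝ ∞ g) :
    ContDiff ℝ ∞ (f * g) := hf.mul hg

lemma ContDiff.csmul {f : E4 → ℝ} (hf : ContDiff ℝ ∞ f) (c : ℝ) : ContDiff ℝ ∞ (c • f) :=
  contDiff_const.mul hf

lemma pd_add {f g : E4 → ℝ} (hf : ContDiff ℝ ∞ f) (hg : ContDiff ℝ ∞ g) (i : Fin 4) :
    pd i (f + g) = pd i f + pd i g := by
  ext x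
  simp [pd, fderiv_add (hf.diffAt x) (hg.diffAt x)]

lemma pd_smul {f : E4 → ℝ} (hf : ContDiff ℝ ∞ f) (c : ℝ) (i : Fin 4) :
    pd i (c • f) = c • pd i f := by
  ext x
  simp [pd, fderiv_const_smul (hf.diffAt x)]

lemma pd_mul {f g : E4 → ℝ} (hf : ContDiff ℝ ∞ f) (hg : ContDiff ℝ ∞ g) (i : Fin 4) :
    pd i (f * g) = pd i f * g + f * pd i g := by
  ext x
  simp [pd, fderiv_mul (hf.diffAt x) (hg.diffAt x)]
  ring

lemma eul_add {f g : E4 → ℝ} (hf : ContDiff ℝ ∞ f) (hg : ContDiff ℝ ∞ g) :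
    eul (f + g) = eul f + eul g := by
  ext x
  simp [eul, fderiv_add (hf.diffAt x) (hg.diffAt x)]

lemma eul_smul {f : E4 → ℝ} (hf : ContDiff ℝ ∞ f) (c : ℝ) : eul (c • f) = c • eul f := by
  ext x
  simp [eul, fderiv_const_smul (hf.diffAt x)]

lemma eul_mul {f g : E4 → ℝ} (hf : ContDiff ℝ ∞ f) (hg : ContDiff ℝ ∞ g) :
    eul (f * g) = eul f * g + f * eul g := by
  ext x
  simp [eul, fderiv_mul (hf.diffAt x) (hg.diffAt x)]
  ring

lemma pd_eul {f : E4 → ℝ} (hf : ContDiff ℝ ∞ f) (i : Fin 4) :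
    pd i (eul f) = pd i f + eul (pd i f) := by
  ext x
  have h2 : DifferentiableAt ℝ (fderiv ℝ f) x :=
    (hf.fderiv_right (m := ∞) (by simp)).differentiable (by simp) x
  have hs : IsSymmSndFDerivAt ℝ f x := hf.contDiffAt.isSymmSndFDerivAt (by simp; norm_cast)
  change fderiv ℝ (fun y => fderiv ℝ f y y) x (e4 i) =
    fderiv ℝ f x (e4 i) + fderiv ℝ (fun y => fderiv ℝ f y (e4 i)) x x
  rw [fderiv_clm_apply h2 differentiableAt_fun_id, fderiv_clm_apply h2 (differentiableAt_const _)]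
  simp [hs.eq x (e4 i)]

lemma lap_add {f g : E4 → ℝ} (hf : ContDiff ℝ ∞ f) (hg : ContDiff ℝ ∞ g) :
    lap (f + g) = lap f + lap g := by
  ext x
  simp only [lap_eq_sum, pd_add hf hg, pd_add (hf.pd _) (hg.pd _), Pi.add_apply,
    Finset.sum_add_distrib]

lemma lap_smul {f : E4 → ℝ} (hf : ContDiff ℝ ∞ f) (c : ℝ) : lap (c • f) = c • lap f := by
  ext x
  simp only [lap_eq_sum, pd_smul hf, pd_smul (hf.pd _), Pi.smul_apply, Finset.smul_sum]

lemma lap_eul {f : E4 → ℝ} (hf : ContDiff ℝ ∞ f) :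
    lap (eul f) = (2 : ℝ) • lap f + eul (lap f) := by
  have h : eul (lap f) = fun x => ∑ i, eul (pd i (pd i f)) x := by
    ext x
    have : lap f = fun x => ∑ i, pd i (pd i f) x := rfl
    rw [eul, this, fderiv_fun_sum fun i _ => ((hf.pd i).pd i).diffAt x]
    simp [eul]
  ext x
  simp only [lap_eq_sum, pd_eul hf, pd_add (hf.pd _) (hf.pd _).eul, pd_eul (hf.pd _), h,
    Pi.add_apply, Pi.smul_apply, Finset.sum_add_distrib, smul_eq_mul]
  ring

lemma fderiv_rho (x v : E4) : fderiv ℝ rho x v = -2 * ⟪x, v⟫ := by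
  have h : HasFDerivAt rho (-(2 • innerSL ℝ x)) x :=
    ((hasStrictFDerivAt_norm_sq x).hasFDerivAt).const_sub 1
  simp [h.fderiv]

lemma pd_rho (i : Fin 4) : pd i rho = fun x => -2 * x i := by
  ext x
  simp [pd, fderiv_rho, e4, EuclideanSpace.inner_single_right]

lemma eul_rho : eul rho = (2 : ℝ) • rho + fun _ => -2 := by
  ext x
  simp [eul, fderiv_rho, rho]
  ring

lemma pd_coord (i j : Fin 4) : pd i (fun x => x j) = fun _ => if i = j then 1 else 0 := by
  ext x
  have : (fun x : E4 => x j) = EuclideanSpace.proj (𝕜 := ℝ) j := rfl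
  rw [pd, this, ContinuousLinearMap.fderiv]
  simp [e4, eq_comm]

lemma contDiff_coord (j : Fin 4) : ContDiff ℝ ∞ (fun x : E4 => x j) :=
  (EuclideanSpace.proj (𝕜 := ℝ) j).contDiff

lemma lap_rho : lap rho = fun _ => -8 := by
  ext x
  have : ∀ i : Fin 4, (fun x : E4 => -2 * x i) = (-2 : ℝ) • fun x => x i := fun i => rfl
  simp only [lap_eq_sum, pd_rho, this, pd_smul (contDiff_coord _), pd_coord]
  simp
  norm_num

lemma lap_mul {f g : E4 → ℝ} (hf : ContDiff ℝ ∞ f) (hg : ContDiff ℝ ∞ g) (x : E4) :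
    lap (f * g) x = lap f x * g x + 2 * ∑ i, pd i f x * pd i g x + f x * lap g x := by
  simp only [lap_eq_sum, Finset.sum_mul, Finset.mul_sum, ← Finset.sum_add_distrib]
  refine Finset.sum_congr rfl fun i _ => ?_
  rw [pd_mul hf hg, pd_add (f := pd i f * g) (g := f * pd i g) ((hf.pd i).mul hg) (hf.mul (hg.pd i)),
    pd_mul (hf.pd _) hg, pd_mul hf (hg.pd _)]
  simp only [Pi.add_apply, Pi.mul_apply]
  ring

lemma lap_rho_mul {f : E4 → ℝ} (hf : ContDiff ℝ ∞ f) :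
    lap (rho * f) = (-8 : ℝ) • f + (-4 : ℝ) • eul f + rho * lap f := by
  ext x
  simp only [lap_mul contDiff_rho hf, lap_rho, pd_rho, eul_eq_sum f x, Pi.add_apply, Pi.mul_apply,
    Pi.smul_apply, smul_eq_mul, Finset.mul_sum]
  congr 2
  exact Finset.sum_congr rfl fun i _ => by ring

lemma eul_rho_mul {f : E4 → ℝ} (hf : ContDiff ℝ ∞ f) :
    eul (rho * f) = (2 : ℝ) • (rho * f) + (-2 : ℝ) • f + rho * eul f := by
  ext x
  simp [eul_mul contDiff_rho hf, eul_rho]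
  ring

lemma second_deriv_nonpos_of_isLocalMax {g : ℝ → ℝ} (hg : ContDiff ℝ ∞ g)
    (h : IsLocalMax g 0) : deriv (deriv g) 0 ≤ 0 := by
  by_contra! hpos
  have hmin := isLocalMin_of_deriv_deriv_pos hpos h.deriv_eq_zero hg.continuous.continuousAt
  have hc : g =ᶠ[𝓝 0] fun _ => g 0 := by
    filter_upwards [h, hmin] with t h1 h2 using le_antisymm h1 h2
  rw [hc.deriv.deriv_eq] at hpos
  simp at hpos

lemma hasDerivAt_line {f : E4 → ℝ} (hf : ContDiff ℝ ∞ f) (x v : E4) (t : ℝ) :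
    HasDerivAt (fun t : ℝ => f (x + t • v)) (fderiv ℝ f (x + t • v) v) t := by
  have hl : HasDerivAt (fun t : ℝ => x + t • v) v t := by
    simpa using ((hasDerivAt_id t).smul_const v).const_add x
  exact (hf.diffAt _).hasFDerivAt.comp_hasDerivAt t hl

lemma pd_pd_nonpos_of_isLocalMax {f : E4 → ℝ} (hf : ContDiff ℝ ∞ f) {x : E4}
    (h : IsLocalMax f x) (i : Fin 4) : pd i (pd i f) x ≤ 0 := by
  let g : ℝ → ℝ := fun t => f (x + t • e4 i)
  have hl : ContDiff ℝ ∞ fun t : ℝ => x + t • e4 i :=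
    contDiff_const.add (contDiff_id.smul contDiff_const)
  have hg0 : IsLocalMax g 0 := by
    have : Filter.Tendsto (fun t : ℝ => x + t • e4 i) (𝓝 0) (𝓝 x) := by
      simpa using hl.continuous.tendsto 0
    simpa [IsLocalMax, IsMaxFilter, g] using this.eventually h
  have hd : deriv g = fun t => pd i f (x + t • e4 i) :=
    funext fun t => (hasDerivAt_line hf x _ t).deriv
  have := second_deriv_nonpos_of_isLocalMax (g := g) (hf.comp hl) hg0
  rw [hd, (hasDerivAt_line (hf.pd i) x _ 0).deriv] at this
  simpa [pd] using this

/-- Weak maximum principle on the closed unit ball. -/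
lemma le_of_lap_eq_zero {f : E4 → ℝ} (hf : ContDiff ℝ ∞ f)
    (hlap : ∀ x, ‖x‖ < 1 → lap f x = 0) {M : ℝ} (hM : ∀ x, ‖x‖ = 1 → f x ≤ M) {x : E4}
    (hx : ‖x‖ ≤ 1) : f x ≤ M := by
  refine le_of_forall_pos_le_add fun ε hε => ?_
  have hg : ContDiff ℝ ∞ (f + (-ε) • rho) := hf.add (contDiff_rho.csmul _)
  obtain ⟨z, hz, hmax⟩ := (isCompact_closedBall (0 : E4) 1).exists_isMaxOn
    ⟨0, by simp⟩ hg.continuous.continuousOn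
  have hz1 : ‖z‖ = 1 := by
    refine le_antisymm (by simpa using hz) (not_lt.1 fun hlt => ?_)
    have hloc : IsLocalMax (f + (-ε) • rho) z :=
      hmax.isLocalMax (Metric.closedBall_mem_nhds_of_mem (by simpa using hlt))
    have h1 : lap (f + (-ε) • rho) z ≤ 0 :=
      Finset.sum_nonpos fun i _ => pd_pd_nonpos_of_isLocalMax hg hloc i
    rw [lap_add hf (contDiff_rho.csmul _), lap_smul contDiff_rho, lap_rho] at h1
    simp only [Pi.add_apply, Pi.smul_apply, hlap z hlt, smul_eq_mul] at h1
    linarith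
  have h2 : (f + (-ε) • rho) x ≤ (f + (-ε) • rho) z := hmax (by simpa using hx)
  simp only [rho, Pi.add_apply, Pi.smul_apply, smul_eq_mul, hz1] at h2
  have h3 := hM z hz1
  nlinarith [norm_nonneg x, sq_nonneg ‖x‖]

lemma abs_le_of_lap_eq_zero {f : E4 → ℝ} (hf : ContDiff ℝ ∞ f)
    (hlap : ∀ x, ‖x‖ < 1 → lap f x = 0) {M : ℝ} (hM : ∀ x, ‖x‖ = 1 → |f x| ≤ M) {x : E4}
    (hx : ‖x‖ ≤ 1) : |f x| ≤ M := by
  refine abs_le.2 ⟨?_, le_of_lap_eq_zero hf hlap (fun y hy => (le_abs_self _).trans (hM y hy)) hx⟩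
  have := le_of_lap_eq_zero (f := (-1 : ℝ) • f) (hf.csmul _)
    (fun y hy => by rw [lap_smul hf]; simp [hlap y hy])
    (fun y hy => by simpa using (neg_le_abs _).trans (hM y hy)) hx
  simp only [Pi.smul_apply, smul_eq_mul] at this
  linarith

lemma eq_zero_of_lap_eq_zero {f : E4 → ℝ} (hf : ContDiff ℝ ∞ f)
    (hlap : ∀ x, ‖x‖ < 1 → lap f x = 0) (h0 : ∀ x, ‖x‖ = 1 → f x = 0) {x : E4}
    (hx : ‖x‖ ≤ 1) : f x = 0 :=
  abs_nonpos_iff.1 (abs_le_of_lap_eq_zero hf hlap (fun y hy => by simp [h0 y hy]) hx)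

lemma eq_apply_zero_of_eul_eq_zero {f : E4 → ℝ} (hf : ContDiff ℝ ∞ f)
    (h : ∀ x, ‖x‖ < 1 → eul f x = 0) {x : E4} (hx : ‖x‖ ≤ 1) : f x = f 0 := by
  have hd : ∀ t : ℝ, HasDerivAt (fun t : ℝ => f (t • x)) (fderiv ℝ f (t • x) x) t := fun t => by
    simpa using hasDerivAt_line hf 0 x t
  obtain ⟨t, ht, he⟩ := exists_hasDerivAt_eq_slope (fun t : ℝ => f (t • x)) _ zero_lt_one
    (fun t _ => (hd t).continuousAt.continuousWithinAt) fun t _ => hd t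
  have h1 : ‖t • x‖ < 1 := by
    rw [norm_smul, Real.norm_of_nonneg ht.1.le]
    nlinarith [ht.1, ht.2, norm_nonneg x]
  have h2 := h _ h1
  simp only [eul, map_smul, smul_eq_mul, mul_eq_zero, ht.1.ne', false_or] at h2
  rw [h2] at he
  simp at he
  linarith

lemma eq_zero_of_eul_add_self_eq_zero {f : E4 → ℝ} (hf : ContDiff ℝ ∞ f)
    (h : ∀ x, ‖x‖ ≤ 1 → eul f x + f x = 0) {x : E4} (hx : ‖x‖ ≤ 1) : f x = 0 := by
  have hd : ∀ t : ℝ, HasDerivAt (fun t : ℝ => t * f (t • x))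
      (1 * f (t • x) + t * fderiv ℝ f (t • x) x) t := fun t => by
    simpa using (hasDerivAt_id t).fun_mul (hasDerivAt_line hf 0 x t)
  obtain ⟨t, ht, he⟩ := exists_hasDerivAt_eq_slope (fun t : ℝ => t * f (t • x)) _ zero_lt_one
    (fun t _ => (hd t).continuousAt.continuousWithinAt) fun t _ => hd t
  have h1 : ‖t • x‖ ≤ 1 := by
    rw [norm_smul, Real.norm_of_nonneg ht.1.le]
    nlinarith [ht.1, ht.2, norm_nonneg x]
  have h2 := h _ h1
  simp only [eul, map_smul, smul_eq_mul] at h2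
  simp at he
  linarith

lemma sphLap_congr {f g : E4 → ℝ} (h : ∀ x, ‖x‖ = 1 → f x = g x) {x : E4} (hx : ‖x‖ = 1) :
    sphLap f x = sphLap g x := by
  have hev : (fun y : E4 => f (‖y‖⁻¹ • y)) =ᶠ[𝓝 x] fun y => g (‖y‖⁻¹ • y) := by
    have hx0 : x ≠ 0 := fun h => by simp [h] at hx
    filter_upwards [isOpen_ne.mem_nhds hx0] with y hy
    exact h _ (by rw [norm_smul, norm_inv, norm_norm, inv_mul_cancel₀ (norm_ne_zero_iff.2 hy)])
  unfold sphLap lap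
  refine Finset.sum_congr rfl fun i _ => ?_
  have : (fun y => fderiv ℝ (fun y : E4 => f (‖y‖⁻¹ • y)) y (e4 i)) =ᶠ[𝓝 x]
      fun y => fderiv ℝ (fun y : E4 => g (‖y‖⁻¹ • y)) y (e4 i) :=
    (hev.fderiv (𝕜 := ℝ)).mono fun y hy => by simp only [hy]
  rw [this.fderiv_eq]

lemma hasFDerivAt_inv_norm {x : E4} (hx : x ≠ 0) :
    HasFDerivAt (fun y : E4 => ‖y‖⁻¹) (-(‖x‖⁻¹ ^ 3) • innerSL ℝ x) x := by
  have h1 : HasFDerivAt (fun y : E4 => ‖y‖ ^ 2) (2 • innerSL ℝ x) x :=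
    (hasStrictFDerivAt_norm_sq x).hasFDerivAt
  have hn : ‖x‖ ≠ 0 := norm_ne_zero_iff.2 hx
  have h2 := (hasDerivAt_inv (x := √(‖x‖ ^ 2)) (by positivity)).comp_hasFDerivAt x
    (h1.sqrt (by positivity))
  refine (h2.congr_fderiv ?_).congr_of_eventuallyEq (.of_forall fun y => by simp)
  ext y
  simp
  field_simp

lemma pd_comp_normalize {f : E4 → ℝ} (hf : ContDiff ℝ ∞ f) (i : Fin 4) {x : E4} (hx : x ≠ 0) :
    pd i (fun y => f (‖y‖⁻¹ • y)) x =
      ‖x‖⁻¹ * (pd i f + (-1 : ℝ) • ((fun y : E4 => y i) * eul f)) (‖x‖⁻¹ • x) := by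
  have h1 := (hasFDerivAt_inv_norm hx).smul (hasFDerivAt_id x)
  have h2 : HasFDerivAt (fun y : E4 => f (‖y‖⁻¹ • y)) _ x :=
    HasFDerivAt.comp x (hf.diffAt (‖x‖⁻¹ • x)).hasFDerivAt h1
  have h3 : ‖x‖ * ‖x‖⁻¹ = 1 := mul_inv_cancel₀ (norm_ne_zero_iff.2 hx)
  rw [pd, h2.fderiv]
  simp [pd, eul, e4, EuclideanSpace.inner_single_right]
  ring

lemma sphLap_eq {f : E4 → ℝ} (hf : ContDiff ℝ ∞ f) {x : E4} (hx : ‖x‖ = 1) :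
    sphLap f x = lap f x - eul (eul f) x - 2 * eul f x := by
  have hx0 : x ≠ 0 := fun h => by simp [h] at hx
  have hsm : ∀ i : Fin 4, ContDiff ℝ ∞ (pd i f + (-1 : ℝ) • ((fun y : E4 => y i) * eul f)) := fun i =>
    (hf.pd i).add (((contDiff_coord i).mul hf.eul).csmul _)
  have hE : ∀ i : Fin 4, eul (fun y : E4 => y i) = fun y => y i := fun i => by
    ext y
    simp [eul_eq_sum, pd_coord]
  have key : ∀ i : Fin 4, pd i (pd i (fun y => f (‖y‖⁻¹ • y))) x =
      pd i (pd i f) x - eul f x - x i * pd i (eul f) x - x i * pd i f x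
        + x i * x i * (2 * eul f x + eul (eul f) x)
        - x i * eul (pd i f) x := by
    intro i
    have hm : ContDiff ℝ ∞ ((fun y : E4 => y i) * eul f) := (contDiff_coord i).mul hf.eul
    have hev : pd i (fun y => f (‖y‖⁻¹ • y)) =ᶠ[𝓝 x] fun y =>
        ‖y‖⁻¹ * (pd i f + (-1 : ℝ) • ((fun y : E4 => y i) * eul f)) (‖y‖⁻¹ • y) := by
      filter_upwards [isOpen_ne.mem_nhds hx0] with y hy using pd_comp_normalize hf i hy
    have h1 : DifferentiableAt ℝ (fun y : E4 =>
        (pd i f + (-1 : ℝ) • ((fun y : E4 => y i) * eul f)) (‖y‖⁻¹ • y)) x :=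
      ((hsm i).diffAt _).comp x
        ((hasFDerivAt_inv_norm hx0).differentiableAt.smul differentiableAt_id)
    have h2 := pd_comp_normalize (hsm i) i hx0
    rw [pd] at h2
    rw [pd, hev.fderiv_eq, fderiv_fun_mul (hasFDerivAt_inv_norm hx0).differentiableAt h1]
    simp only [add_apply, smul_apply, h2,
      (hasFDerivAt_inv_norm hx0).fderiv]
    rw [pd_add (hf.pd i) (hm.csmul _), pd_smul hm, pd_mul (contDiff_coord i) hf.eul, pd_coord,
      eul_add (hf.pd i) (hm.csmul _), eul_smul hm, eul_mul (contDiff_coord i) hf.eul, hE]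
    simp [hx, e4, EuclideanSpace.inner_single_right]
    ring
  have hn : ∑ i, x i * x i = 1 := by
    have := EuclideanSpace.norm_sq_eq x
    rw [hx] at this
    simpa [← sq] using this.symm
  have hs : eul f x = ∑ i, x i * pd i f x := eul_eq_sum f x
  have hs2 : eul (eul f) x = ∑ i, x i * pd i (eul f) x := eul_eq_sum (eul f) x
  have hs3 : ∑ i, x i * eul (pd i f) x = eul (eul f) x - eul f x := by
    rw [hs2, hs, ← Finset.sum_sub_distrib]
    refine Finset.sum_congr rfl fun i _ => ?_
    rw [pd_eul hf]
    simp only [Pi.add_apply]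
    ring
  change ∑ i, pd i (pd i (fun y => f (‖y‖⁻¹ • y))) x = _
  simp only [key, Finset.sum_sub_distrib, Finset.sum_add_distrib, ← Finset.sum_mul, hn,
    ← hs, ← hs2, hs3]
  simp [lap_eq_sum]
  ring

lemma muM_eq (f : E4 → ℝ) : muM f = (-1 : ℝ) • eul f := by
  ext x
  simp [muM, eul]

lemma P3M_eq {u : E4 → ℝ} (hu : ContDiff ℝ ∞ u) {x : E4} (hx : ‖x‖ = 1) :
    P3M u x = eul (eul (eul u)) x + 3 * eul (eul u) x + 2 * eul u x - 3 * lap u x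
      - 3 / 2 * eul (lap u) x := by
  rw [P3M, muM_eq, muM_eq, sphLap_eq (hu.eul.csmul _) hx, sphLap_eq hu hx, lap_smul hu.eul,
    lap_eul hu, eul_smul hu.eul, eul_smul hu.eul.eul]
  simp only [Pi.add_apply, Pi.smul_apply, smul_eq_mul]
  ring

/-- The radial antiderivative of `biharmK`, equal to `2 u` on the unit sphere. -/
def biharmR (u : E4 → ℝ) : E4 → ℝ :=
  rho * eul u + (2 : ℝ) • u + (1 / 4 : ℝ) • (rho * (rho * lap u))

/-- A harmonic function attached to a biharmonic function `u`, with
`(1 + eul) (biharmK u) = P3M u` on the unit sphere. -/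
def biharmK (u : E4 → ℝ) : E4 → ℝ :=
  eul (eul u) + (2 : ℝ) • eul u + (-1 : ℝ) • lap u + rho * lap u + (1 / 4 : ℝ) • (rho * eul (lap u))

/-- A harmonic function attached to a biharmonic function `u`, equal to `muM u / 2` on the unit
sphere. -/
def biharmV (u : E4 → ℝ) : E4 → ℝ :=
  (-1 / 2 : ℝ) • eul u + (-1 / 8 : ℝ) • (rho * lap u)

lemma contDiff_biharmK {u : E4 → ℝ} (hu : ContDiff ℝ ∞ u) : ContDiff ℝ ∞ (biharmK u) :=
  ((((hu.eul.eul).cadd (hu.eul.csmul _)).cadd (hu.lap.csmul _)).cadd (contDiff_rho.cmul hu.lap)).cadd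
    ((contDiff_rho.cmul hu.lap.eul).csmul _)

lemma contDiff_biharmR {u : E4 → ℝ} (hu : ContDiff ℝ ∞ u) : ContDiff ℝ ∞ (biharmR u) :=
  ((contDiff_rho.cmul hu.eul).cadd (hu.csmul _)).cadd
    ((contDiff_rho.cmul (contDiff_rho.cmul hu.lap)).csmul _)

lemma contDiff_biharmV {u : E4 → ℝ} (hu : ContDiff ℝ ∞ u) : ContDiff ℝ ∞ (biharmV u) :=
  (hu.eul.csmul _).cadd ((contDiff_rho.cmul hu.lap).csmul _)

lemma lap_biharmK {u : E4 → ℝ} (hu : ContDiff ℝ ∞ u) : lap (biharmK u) =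
    (-1 : ℝ) • lap (lap u) + rho * lap (lap u)
      + (1 / 4 : ℝ) • (rho * ((2 : ℝ) • lap (lap u) + eul (lap (lap u)))) := by
  have h1 := hu.eul.eul
  have h2 := hu.eul.csmul 2
  have h3 := hu.lap.csmul (-1)
  have h4 := contDiff_rho.cmul hu.lap
  have h5 := contDiff_rho.cmul hu.lap.eul
  rw [biharmK, lap_add (((h1.cadd h2).cadd h3).cadd h4) (h5.csmul _), lap_add ((h1.cadd h2).cadd h3) h4,
    lap_add (h1.cadd h2) h3, lap_add h1 h2, lap_eul hu.eul, lap_eul hu, lap_smul hu.eul, lap_eul hu,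
    lap_smul hu.lap, lap_smul h5, lap_rho_mul hu.lap, lap_rho_mul hu.lap.eul, lap_eul hu.lap,
    eul_add (hu.lap.csmul _) hu.lap.eul, eul_smul hu.lap]
  ext x
  simp only [Pi.add_apply, Pi.smul_apply, Pi.mul_apply, smul_eq_mul]
  ring

lemma eul_biharmK_add {u : E4 → ℝ} (hu : ContDiff ℝ ∞ u) {x : E4} (hx : ‖x‖ = 1) :
    eul (biharmK u) x + biharmK u x = P3M u x := by
  have h1 := hu.eul.eul
  have h2 := hu.eul.csmul 2
  have h3 := hu.lap.csmul (-1)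
  have h4 := contDiff_rho.cmul hu.lap
  have h5 := contDiff_rho.cmul hu.lap.eul
  rw [P3M_eq hu hx, biharmK, eul_add (((h1.cadd h2).cadd h3).cadd h4) (h5.csmul _),
    eul_add ((h1.cadd h2).cadd h3) h4, eul_add (h1.cadd h2) h3, eul_add h1 h2, eul_smul hu.eul,
    eul_smul hu.lap, eul_smul h5, eul_rho_mul hu.lap, eul_rho_mul hu.lap.eul]
  simp only [Pi.add_apply, Pi.smul_apply, Pi.mul_apply, smul_eq_mul, rho, hx]
  ring

lemma eul_biharmR {u : E4 → ℝ} (hu : ContDiff ℝ ∞ u) : eul (biharmR u) = rho * biharmK u := by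
  have h1 := contDiff_rho.cmul hu.eul
  have h4 := contDiff_rho.cmul hu.lap
  have h5 := contDiff_rho.cmul h4
  rw [biharmR, eul_add (h1.cadd (hu.csmul _)) (h5.csmul _), eul_add h1 (hu.csmul _), eul_smul hu,
    eul_smul h5, eul_rho_mul hu.eul, eul_rho_mul h4, eul_rho_mul hu.lap, biharmK]
  ext x
  simp only [Pi.add_apply, Pi.smul_apply, Pi.mul_apply, smul_eq_mul]
  ring

lemma lap_biharmV {u : E4 → ℝ} (hu : ContDiff ℝ ∞ u) : lap (biharmV u) = (-1 / 8 : ℝ) • (rho * lap (lap u)) := by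
  have h4 := contDiff_rho.cmul hu.lap
  rw [biharmV, lap_add (hu.eul.csmul _) (h4.csmul _), lap_smul hu.eul, lap_smul h4, lap_eul hu,
    lap_rho_mul hu.lap]
  ext x
  simp only [Pi.add_apply, Pi.smul_apply, Pi.mul_apply, smul_eq_mul]
  ring

lemma biharmR_eq : biharmR u = (2 : ℝ) • (u + (-1 : ℝ) • (rho * biharmV u)) := by
  ext x
  simp only [biharmR, biharmV, Pi.add_apply, Pi.smul_apply, Pi.mul_apply, smul_eq_mul]
  ring

lemma pd_eq_zero_of_eq_zero {f : E4 → ℝ} (h : ∀ x, ‖x‖ < 1 → f x = 0) (i : Fin 4) {x : E4}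
    (hx : ‖x‖ < 1) : pd i f x = 0 := by
  have : f =ᶠ[𝓝 x] fun _ => 0 := by
    filter_upwards [(isOpen_lt continuous_norm continuous_const).mem_nhds hx] with y hy using h y hy
  simp [pd, this.fderiv_eq]

lemma eul_eq_zero_of_eq_zero {f : E4 → ℝ} (h : ∀ x, ‖x‖ < 1 → f x = 0) {x : E4} (hx : ‖x‖ < 1) :
    eul f x = 0 := by
  simp [eul_eq_sum, pd_eq_zero_of_eq_zero h _ hx]

lemma lap_eq_zero_of_eq_zero {f : E4 → ℝ} (h : ∀ x, ‖x‖ < 1 → f x = 0) {x : E4} (hx : ‖x‖ < 1) :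
    lap f x = 0 :=
  Finset.sum_eq_zero fun i _ => pd_eq_zero_of_eq_zero (fun _ hy => pd_eq_zero_of_eq_zero h i hy) i hx

lemma biharmR_eq_const {u : E4 → ℝ} (hu : ContDiff ℝ ∞ u) (hΔ : ∀ x, ‖x‖ < 1 → lap (lap u) x = 0) (hP : ∀ x, ‖x‖ = 1 → P3M u x = 0)
    {x : E4} (hx : ‖x‖ ≤ 1) : biharmR u x = biharmR u 0 := by
  have hK := contDiff_biharmK hu
  have hΔK : ∀ y, ‖y‖ < 1 → lap (biharmK u) y = 0 := fun y hy => by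
    simp [lap_biharmK hu, hΔ y hy, eul_eq_zero_of_eq_zero hΔ hy]
  have h1 : ∀ y, ‖y‖ ≤ 1 → (eul (biharmK u) + biharmK u) y = 0 := fun y hy => by
    refine eq_zero_of_lap_eq_zero (hK.eul.cadd hK) (fun z hz => ?_) (fun z hz => ?_) hy
    · simp [lap_add hK.eul hK, lap_eul hK, hΔK z hz, eul_eq_zero_of_eq_zero hΔK hz]
    · exact (eul_biharmK_add hu hz).trans (hP z hz)
  refine eq_apply_zero_of_eul_eq_zero (contDiff_biharmR hu) (fun y hy => ?_) hx
  simp [eul_biharmR hu, eq_zero_of_eul_add_self_eq_zero hK h1 hy.le]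

lemma eq_const_of_solBall {u : E4 → ℝ} (hu : ContDiff ℝ ∞ u) (hΔ : ∀ x, ‖x‖ < 1 → lap (lap u) x = 0)
    (hP : ∀ x, ‖x‖ = 1 → P3M u x = 0) {x : E4} (hx : ‖x‖ = 1) : u x = biharmR u 0 / 2 := by
  have h1 := biharmR_eq_const hu hΔ hP hx.le
  have h2 : biharmR u x = 2 * u x := by simp [biharmR, rho, hx]
  linarith

lemma eq_rho_mul_of_solBall {u : E4 → ℝ} (hu : ContDiff ℝ ∞ u) (hΔ : ∀ x, ‖x‖ < 1 → lap (lap u) x = 0)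
    (hP : ∀ x, ‖x‖ = 1 → P3M u x = 0) (h0 : ∀ x, ‖x‖ = 1 → u x = 0) {x : E4} (hx : ‖x‖ ≤ 1) :
    u x = rho x * biharmV u x := by
  have he : ‖e4 0‖ = 1 := by simp [e4]
  have h1 := eq_const_of_solBall hu hΔ hP he
  have h2 := biharmR_eq_const hu hΔ hP hx
  have h3 : biharmR u x = 2 * (u x - rho x * biharmV u x) := by
    simp [biharmR_eq]
    ring
  rw [h0 _ he] at h1
  linarith

lemma lap_biharmV_eq_zero {u : E4 → ℝ} (hu : ContDiff ℝ ∞ u) (hΔ : ∀ x, ‖x‖ < 1 → lap (lap u) x = 0) {x : E4} (hx : ‖x‖ < 1) :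
    lap (biharmV u) x = 0 := by
  simp [lap_biharmV hu, hΔ x hx]

lemma biharmV_eq_of_norm_eq_one {x : E4} (hx : ‖x‖ = 1) : biharmV u x = muM u x / 2 := by
  simp [biharmV, muM_eq, rho, hx]
  ring

lemma SolBall.eqOn {φ u₁ u₂ : E4 → ℝ} (h₁ : SolBall φ u₁) (h₂ : SolBall φ u₂)
    (hz₁ : ∀ x, ‖x‖ = 1 → u₁ x = 0) (hz₂ : ∀ x, ‖x‖ = 1 → u₂ x = 0) :
    EqOn u₁ u₂ (Metric.closedBall 0 1) := by
  intro x hx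
  have hx1 : ‖x‖ ≤ 1 := by simpa using hx
  obtain ⟨c₁, d₁, p₁, m₁⟩ := h₁
  obtain ⟨c₂, d₂, p₂, m₂⟩ := h₂
  have hv := contDiff_biharmV c₂
  have key : (biharmV u₁ + (-1 : ℝ) • biharmV u₂) x = 0 := by
    refine eq_zero_of_lap_eq_zero ((contDiff_biharmV c₁).cadd (hv.csmul _)) (fun y hy => ?_)
      (fun y hy => ?_) hx1
    · rw [lap_add (contDiff_biharmV c₁) (hv.csmul _), lap_smul hv]
      simp [lap_biharmV_eq_zero c₁ d₁ hy, lap_biharmV_eq_zero c₂ d₂ hy]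
    · simp [biharmV_eq_of_norm_eq_one hy, m₁ y hy, m₂ y hy]
  rw [eq_rho_mul_of_solBall c₁ d₁ p₁ hz₁ hx1, eq_rho_mul_of_solBall c₂ d₂ p₂ hz₂ hx1]
  simp only [Pi.add_apply, Pi.smul_apply, smul_eq_mul] at key
  rw [show biharmV u₁ x = biharmV u₂ x by linarith]

lemma SolBall.abs_le {φ u : E4 → ℝ} (h : SolBall φ u) (hz : ∀ x, ‖x‖ = 1 → u x = 0) {x : E4}
    (hx : ‖x‖ ≤ 1) : |u x| ≤ ⨆ y : Metric.sphere (0 : E4) 1, |φ y| := by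
  obtain ⟨c, d, p, m⟩ := h
  have hφ : ∀ y : Metric.sphere (0 : E4) 1, φ y = -eul u y := fun y => by
    simp [← m y (by simp), muM_eq]
  have hbdd : BddAbove (range fun y : Metric.sphere (0 : E4) 1 => |φ y|) := by
    simp only [hφ, abs_neg]
    exact isCompact_range ((c.eul.continuous.comp continuous_subtype_val).abs) |>.bddAbove
  have hV : |biharmV u x| ≤ (⨆ y : Metric.sphere (0 : E4) 1, |φ y|) / 2 := by
    refine abs_le_of_lap_eq_zero (contDiff_biharmV c) (fun y hy => lap_biharmV_eq_zero c d hy)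
      (fun y hy => ?_) hx
    rw [biharmV_eq_of_norm_eq_one hy, m y hy, abs_div, abs_two]
    exact div_le_div_of_nonneg_right (le_ciSup hbdd ⟨y, by simpa using hy⟩) two_pos.le
  rw [eq_rho_mul_of_solBall c d p hz hx, abs_mul]
  have hr : |rho x| ≤ 1 := by
    rw [rho, abs_of_nonneg (by nlinarith [norm_nonneg x])]
    nlinarith [norm_nonneg x]
  nlinarith [abs_nonneg (biharmV u x), abs_nonneg (rho x)]

lemma lap_eq_zero_of_norm_le {G : E4 → ℝ} (hG : ContDiff ℝ ∞ G)
    (hΔ : ∀ x, ‖x‖ < 1 → lap G x = 0) {x : E4} (hx : ‖x‖ ≤ 1) : lap G x = 0 := by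
  have hcl : closure (Metric.ball (0 : E4) 1) ⊆ {y | lap G y = 0} :=
    closure_minimal (fun y hy => hΔ y (by simpa using hy))
      (isClosed_eq hG.lap.continuous continuous_const)
  exact hcl (by simpa [closure_ball] using hx)

lemma solBall_of_harmonic {φ G : E4 → ℝ} (hG : ContDiff ℝ ∞ G)
    (hΔ : ∀ x, ‖x‖ < 1 → lap G x = 0) (hφ : ∀ x, ‖x‖ = 1 → G x = φ x) :
    SolBall φ ((1 / 2 : ℝ) • (rho * G)) := by
  have hm := contDiff_rho.cmul hG
  have hr := contDiff_rho.cmul hG.lap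
  have hlap : lap ((1 / 2 : ℝ) • (rho * G)) =
      (-4 : ℝ) • G + (-2 : ℝ) • eul G + (1 / 2 : ℝ) • (rho * lap G) := by
    rw [lap_smul hm, lap_rho_mul hG]
    ext x
    simp only [Pi.add_apply, Pi.smul_apply, Pi.mul_apply, smul_eq_mul]
    ring
  have hmu : muM ((1 / 2 : ℝ) • (rho * G)) =
      G + (-1 : ℝ) • (rho * G) + (-1 / 2 : ℝ) • (rho * eul G) := by
    rw [muM_eq, eul_smul hm, eul_rho_mul hG]
    ext x
    simp only [Pi.add_apply, Pi.smul_apply, Pi.mul_apply, smul_eq_mul]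
    ring
  have hmu1 : ∀ x, ‖x‖ = 1 → muM ((1 / 2 : ℝ) • (rho * G)) x = G x := fun x hx => by
    rw [hmu]
    simp [rho, hx]
  refine ⟨hm.csmul _, fun x hx => ?_, fun x hx => ?_, fun x hx => (hmu1 x hx).trans (hφ x hx)⟩
  · rw [hlap, lap_add ((hG.csmul _).cadd (hG.eul.csmul _)) (hr.csmul _),
      lap_add (hG.csmul _) (hG.eul.csmul _), lap_smul hG, lap_smul hG.eul, lap_eul hG, lap_smul hr,
      lap_rho_mul hG.lap]
    simp [hΔ x hx, lap_eq_zero_of_eq_zero hΔ hx, eul_eq_zero_of_eq_zero hΔ hx]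
  · have h0 : sphLap ((1 / 2 : ℝ) • (rho * G)) x = 0 := by
      rw [sphLap_congr (g := fun _ => 0) (fun y hy => by simp [rho, hy]) hx]
      simp [sphLap, lap]
    rw [P3M, h0, sphLap_congr hmu1 hx, sphLap_eq hG hx, hlap, muM_eq,
      eul_add ((hG.csmul _).cadd (hG.eul.csmul _)) (hr.csmul _),
      eul_add (hG.csmul _) (hG.eul.csmul _), eul_smul hG, eul_smul hG.eul, eul_smul hr,
      eul_rho_mul hG.lap]
    simp only [Pi.add_apply, Pi.smul_apply, Pi.mul_apply, smul_eq_mul, rho, hx,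
      lap_eq_zero_of_norm_le hG hΔ hx.le]
    ring

open MvPolynomial in
/-- The function on `ℝ⁴` defined by a polynomial in four variables. -/
def mvFun (P : MvPolynomial (Fin 4) ℝ) : E4 → ℝ := fun x => eval (fun i => x i) P

lemma mvFun_C (c : ℝ) : mvFun (.C c) = fun _ => c := by
  ext x
  simp [mvFun]

lemma mvFun_X (i : Fin 4) : mvFun (.X i) = fun x => x i := by
  ext x
  simp [mvFun]

lemma mvFun_add (P Q : MvPolynomial (Fin 4) ℝ) : mvFun (P + Q) = mvFun P + mvFun Q := by
  ext x
  simp [mvFun]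

lemma mvFun_mul (P Q : MvPolynomial (Fin 4) ℝ) : mvFun (P * Q) = mvFun P * mvFun Q := by
  ext x
  simp [mvFun]

lemma contDiff_mvFun (P : MvPolynomial (Fin 4) ℝ) : ContDiff ℝ ∞ (mvFun P) := by
  induction P using MvPolynomial.induction_on with
  | C c => rw [mvFun_C]; exact contDiff_const
  | add P Q hP hQ => rw [mvFun_add]; exact hP.cadd hQ
  | mul_X P i hP => rw [mvFun_mul, mvFun_X]; exact hP.cmul (contDiff_coord i)

lemma pd_mvFun (i : Fin 4) (P : MvPolynomial (Fin 4) ℝ) :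
    pd i (mvFun P) = mvFun (MvPolynomial.pderiv i P) := by
  induction P using MvPolynomial.induction_on with
  | C c =>
    ext x
    simp [mvFun_C, pd, mvFun]
  | add P Q hP hQ =>
    rw [mvFun_add, pd_add (contDiff_mvFun P) (contDiff_mvFun Q), hP, hQ, map_add, mvFun_add]
  | mul_X P j hP =>
    rw [mvFun_mul, mvFun_X, pd_mul (contDiff_mvFun P) (contDiff_coord j), hP, pd_coord]
    ext x
    by_cases h : j = i
    · simp [mvFun, MvPolynomial.pderiv_X, h]
      ring
    · simp [mvFun, MvPolynomial.pderiv_X, h, Ne.symm h]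
      ring

lemma totalDegree_pderiv_le {σ R : Type*} [CommSemiring R] (i : σ) (P : MvPolynomial σ R) {d : ℕ}
    (h : P.totalDegree ≤ d + 1) : (MvPolynomial.pderiv i P).totalDegree ≤ d := by
  classical
  refine Finset.sup_le fun m hm => ?_
  rw [MvPolynomial.mem_support_iff, MvPolynomial.coeff_pderiv] at hm
  have h1 := (MvPolynomial.le_totalDegree
    (MvPolynomial.mem_support_iff.2 (left_ne_zero_of_mul hm))).trans h
  rw [Finsupp.sum_add_index' (by simp) (by simp), Finsupp.sum_single_index rfl] at h1
  omega

/-- The Laplacian on polynomials. -/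
def mvLap : MvPolynomial (Fin 4) ℝ →ₗ[ℝ] MvPolynomial (Fin 4) ℝ :=
  ∑ i, (MvPolynomial.pderiv i).toLinearMap ∘ₗ (MvPolynomial.pderiv i).toLinearMap

lemma mvLap_apply (P : MvPolynomial (Fin 4) ℝ) :
    mvLap P = ∑ i, MvPolynomial.pderiv i (MvPolynomial.pderiv i P) := by
  simp [mvLap]

lemma lap_mvFun (P : MvPolynomial (Fin 4) ℝ) : lap (mvFun P) = mvFun (mvLap P) := by
  ext x
  simp only [lap_eq_sum, pd_mvFun, mvLap_apply]
  simp [mvFun]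

lemma totalDegree_mvLap_le (P : MvPolynomial (Fin 4) ℝ) {d : ℕ} (h : P.totalDegree ≤ d + 2) :
    (mvLap P).totalDegree ≤ d := by
  rw [mvLap_apply]
  exact MvPolynomial.totalDegree_finsetSum_le fun i _ =>
    totalDegree_pderiv_le i _ (totalDegree_pderiv_le i P h)

/-- The polynomial `1 - ∑ Xᵢ²`. -/
def mvRho : MvPolynomial (Fin 4) ℝ := 1 - ∑ i, .X i ^ 2

lemma mvFun_mvRho : mvFun mvRho = rho := by
  ext x
  simp [mvFun, mvRho, rho, EuclideanSpace.norm_sq_eq]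

lemma totalDegree_mvRho_mul_le (P : MvPolynomial (Fin 4) ℝ) {d : ℕ} (h : P.totalDegree ≤ d) :
    (mvRho * P).totalDegree ≤ d + 2 := by
  have h1 : mvRho.totalDegree ≤ 2 := by
    refine (MvPolynomial.totalDegree_sub _ _).trans (max_le (by simp) ?_)
    exact MvPolynomial.totalDegree_finsetSum_le fun i _ => by simp
  exact (MvPolynomial.totalDegree_mul _ _).trans (by omega)

lemma eq_zero_of_mvLap_mvRho_mul {P : MvPolynomial (Fin 4) ℝ} (h : mvLap (mvRho * P) = 0) :
    P = 0 := by
  have h0 : ∀ x : E4, ‖x‖ < 1 → mvFun P x = 0 := fun x hx => by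
    have h1 : mvFun (mvRho * P) x = 0 := by
      refine eq_zero_of_lap_eq_zero (contDiff_mvFun _) (fun y _ => ?_) (fun y hy => ?_) hx.le
      · simp [lap_mvFun, h, mvFun]
      · simp [mvFun_mul, mvFun_mvRho, rho, hy]
    rw [mvFun_mul, mvFun_mvRho] at h1
    refine (mul_eq_zero.1 h1).resolve_left ?_
    simp only [rho]
    nlinarith [norm_nonneg x]
  refine MvPolynomial.funext_set (fun _ => Icc (-1 / 4 : ℝ) (1 / 4))
    (fun _ => Icc_infinite (by norm_num)) fun x hx => ?_
  have hx' : ∀ i, x i ^ 2 ≤ 1 / 16 := fun i => by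
    have := hx i trivial
    nlinarith [this.1, this.2]
  have hn : ‖WithLp.toLp 2 x‖ ^ 2 < 1 := by
    rw [EuclideanSpace.norm_sq_eq, Fin.sum_univ_four]
    simp only [Real.norm_eq_abs, sq_abs]
    linarith [hx' 0, hx' 1, hx' 2, hx' 3]
  simpa [mvFun] using h0 (WithLp.toLp 2 x) (by nlinarith [norm_nonneg (WithLp.toLp 2 x)])

/-- Solvability of the Dirichlet problem on the ball with polynomial data. -/
lemma exists_harmonic_mvFun (P : MvPolynomial (Fin 4) ℝ) {d : ℕ} (hP : P.totalDegree ≤ d + 2) :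
    ∃ Q : MvPolynomial (Fin 4) ℝ, Q.totalDegree ≤ d + 2 ∧ (∀ x, lap (mvFun Q) x = 0) ∧
      ∀ x, ‖x‖ = 1 → mvFun Q x = mvFun P x := by
  let V := MvPolynomial.restrictTotalDegree (Fin 4) ℝ d
  have hV : ∀ S ∈ V, (mvLap ∘ₗ LinearMap.mulLeft ℝ mvRho) S ∈ V := fun S hS => by
    rw [MvPolynomial.mem_restrictTotalDegree] at hS ⊢
    exact totalDegree_mvLap_le _ (totalDegree_mvRho_mul_le S hS)
  let L : V →ₗ[ℝ] V := (mvLap ∘ₗ LinearMap.mulLeft ℝ mvRho).restrict hV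
  have hinj : Function.Injective L := by
    refine (injective_iff_map_eq_zero L).2 fun S hS => ?_
    exact Subtype.ext (eq_zero_of_mvLap_mvRho_mul (congrArg Subtype.val hS))
  obtain ⟨S, hS⟩ := LinearMap.injective_iff_surjective.1 hinj
    ⟨mvLap P, (MvPolynomial.mem_restrictTotalDegree _ _ _).2 (totalDegree_mvLap_le P hP)⟩
  have hS' : mvLap (mvRho * S) = mvLap P := congrArg Subtype.val hS
  refine ⟨P - mvRho * S, ?_, fun x => ?_, fun x hx => ?_⟩
  · exact (MvPolynomial.totalDegree_sub _ _).trans (max_le hP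
      (totalDegree_mvRho_mul_le _ ((MvPolynomial.mem_restrictTotalDegree _ _ _).1 S.2)))
  · simp [lap_mvFun, hS', mvFun]
  · have : mvFun (mvRho * S) x = 0 := by simp [mvFun_mul, mvFun_mvRho, rho, hx]
    simp only [mvFun] at this ⊢
    simp [this]

open Polynomial Polynomial.Chebyshev in
lemma eval_iterate_derivative_le {n k : ℕ} {p : ℝ[X]} (hp : p.natDegree ≤ n) {M : ℝ} (hM : 0 < M)
    (hb : ∀ x ∈ Icc (-1 : ℝ) 1, |p.eval x| ≤ M) {x : ℝ} (hx : 1 ≤ x) :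
    |(derivative^[k] p).eval x| ≤ M * (derivative^[k] (T ℝ n)).eval x := by
  have key : ∀ c : ℝ, |c| = 1 →
      c * (derivative^[k] p).eval x ≤ M * (derivative^[k] (T ℝ n)).eval x := fun c hc => by
    have hd : (C (c / M) * p).degree ≤ n :=
      degree_le_of_natDegree_le ((natDegree_C_mul_le _ _).trans hp)
    have := eval_iterate_derivative_le_of_forall_abs_le_one (k := k) hx hd fun y hy => by
      rw [eval_mul, eval_C, abs_mul, abs_div, hc, abs_of_pos hM, div_mul_eq_mul_div, one_mul]
      exact div_le_one_of_le₀ (hb y hy) hM.le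
    rw [iterate_derivative_C_mul, eval_mul, eval_C, div_mul_eq_mul_div, div_le_iff₀ hM] at this
    linarith
  refine abs_le'.2 ⟨?_, ?_⟩
  · simpa using key 1 (by simp)
  · simpa using key (-1) (by simp)

open Polynomial.Chebyshev in
lemma eval_T_one_add_le {n : ℕ} (hn : 1 ≤ n) {x : ℝ} (hx : 1 ≤ x) (hx' : x ≤ 1 + 1 / (n : ℝ) ^ 2) :
    (T ℝ n).eval x ≤ cosh 2 := by
  have hn' : (1 : ℝ) ≤ n := by exact_mod_cast hn
  have h0 := Real.arcosh_nonneg hx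
  have h1 : Real.arcosh x ≤ √(x ^ 2 - 1) := by
    rw [← Real.sinh_arcosh hx]
    exact Real.self_le_sinh_iff.2 h0
  have h2 : (n * Real.arcosh x) ^ 2 ≤ 2 ^ 2 := by
    rw [mul_pow]
    have h3 : Real.arcosh x ^ 2 ≤ x ^ 2 - 1 := by
      rw [← Real.sq_sqrt (show 0 ≤ x ^ 2 - 1 by nlinarith)]
      exact pow_le_pow_left₀ h0 h1 2
    have h4 : (n : ℝ) ^ 2 * (x - 1) ≤ 1 := by
      rw [← sub_le_iff_le_add', le_div_iff₀ (by positivity)] at hx'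
      linarith
    have h5 : x ≤ 2 := by nlinarith [mul_nonneg (show 0 ≤ (n : ℝ) ^ 2 - 1 by nlinarith) (sub_nonneg.2 hx)]
    nlinarith [sq_nonneg (n : ℝ)]
  rw [← Real.cosh_arcosh hx, T_real_cosh, Real.cosh_le_cosh, abs_two]
  exact abs_le_of_sq_le_sq (by simpa using h2) two_pos.le

open Polynomial in
lemma exists_polynomial_line {P : MvPolynomial (Fin 4) ℝ} {n : ℕ} (hP : P.totalDegree ≤ n)
    (a b : E4) : ∃ p : ℝ[X], p.natDegree ≤ n ∧ ∀ s : ℝ, p.eval s = mvFun P (a + s • b) := by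
  refine ⟨MvPolynomial.aeval (fun i => C (a i) + C (b i) * X) P, ?_, fun s => ?_⟩
  · simpa using MvPolynomial.aeval_natDegree_le P hP _ (n := 1) fun i => by compute_degree
  · clear hP
    induction P using MvPolynomial.induction_on with
    | C c => simp [mvFun]
    | add P Q hP hQ => rw [map_add, eval_add, hP, hQ, mvFun_add, Pi.add_apply]
    | mul_X P i hP =>
      rw [map_mul, eval_mul, hP, mvFun_mul, Pi.mul_apply, mvFun_X, MvPolynomial.aeval_X]
      simp [mul_comm s]

lemma abs_mvFun_le {P : MvPolynomial (Fin 4) ℝ} {n : ℕ} (hn : 1 ≤ n) (hP : P.totalDegree ≤ n)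
    {M : ℝ} (hM : 0 < M) (hb : ∀ x, ‖x‖ ≤ 1 → |mvFun P x| ≤ M) {x : E4}
    (hx : ‖x‖ ≤ 1 + 1 / (n : ℝ) ^ 2) : |mvFun P x| ≤ cosh 2 * M := by
  rcases le_or_gt ‖x‖ 1 with h1 | h1
  · nlinarith [hb x h1, Real.one_le_cosh 2]
  obtain ⟨p, hp, he⟩ := exists_polynomial_line hP 0 (‖x‖⁻¹ • x)
  have hx0 : ‖x‖ ≠ 0 := by positivity
  have h2 := eval_iterate_derivative_le (k := 0) hp hM (fun s hs => by
    rw [he]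
    refine hb _ ?_
    rw [zero_add, norm_smul, norm_smul, norm_inv, norm_norm, inv_mul_cancel₀ hx0, mul_one]
    exact abs_le.2 hs) h1.le
  rw [Function.iterate_zero_apply, Function.iterate_zero_apply, he, zero_add,
    smul_inv_smul₀ hx0] at h2
  nlinarith [eval_T_one_add_le hn h1.le hx]

lemma abs_pd_mvFun_le {P : MvPolynomial (Fin 4) ℝ} {n : ℕ} (hn : 1 ≤ n) (hP : P.totalDegree ≤ n)
    {M : ℝ} (hM : 0 < M) (hb : ∀ x, ‖x‖ ≤ 1 → |mvFun P x| ≤ M) (i : Fin 4) {x : E4}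
    (hx : ‖x‖ ≤ 1) : |pd i (mvFun P) x| ≤ 2 * cosh 2 * (n : ℝ) ^ 4 * M := by
  have hn' : (1 : ℝ) ≤ n := by exact_mod_cast hn
  have hC : 0 < cosh 2 * M := mul_pos (Real.cosh_pos 2) hM
  set h : ℝ := 1 / (2 * (n : ℝ) ^ 2) with hh
  have hh0 : 0 < h := by positivity
  obtain ⟨p, hp, he⟩ := exists_polynomial_line hP (x - h • e4 i) (h • e4 i)
  have h2 := eval_iterate_derivative_le (k := 1) hp hC (fun s hs => by
    rw [he]
    refine abs_mvFun_le hn hP hM hb ?_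
    have : x - h • e4 i + s • h • e4 i = x + ((s - 1) * h) • e4 i := by module
    rw [this]
    refine (norm_add_le _ _).trans (add_le_add hx ?_)
    rw [norm_smul, e4, PiLp.norm_single, norm_one, mul_one, norm_mul,
      Real.norm_of_nonneg hh0.le, Real.norm_eq_abs]
    have h3 : |s - 1| ≤ 2 := abs_le.2 ⟨by linarith [hs.1], by linarith [hs.2]⟩
    calc |s - 1| * h ≤ 2 * h := by gcongr
      _ = 1 / (n : ℝ) ^ 2 := by rw [hh]; field_simp) le_rfl
  have h4 : HasDerivAt (fun s => p.eval s) (fderiv ℝ (mvFun P) x (h • e4 i)) 1 := by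
    have := hasDerivAt_line (contDiff_mvFun P) (x - h • e4 i) (h • e4 i) 1
    simp only [← he] at this
    simpa using this
  have h5 : p.derivative.eval 1 = h * pd i (mvFun P) x := by
    rw [← Polynomial.deriv, h4.deriv, map_smul, smul_eq_mul, pd]
  simp only [Function.iterate_one, h5, Polynomial.Chebyshev.derivative_T_eval_one] at h2
  rw [abs_mul, abs_of_pos hh0, hh, div_mul_eq_mul_div, one_mul, div_le_iff₀ (by positivity)] at h2
  push_cast at h2
  linarith

lemma fderiv_eq_sum_pd (f : E4 → ℝ) : fderiv ℝ f = fun x => ∑ i,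
    (ContinuousLinearMap.toSpanSingleton ℝ (innerSL ℝ (e4 i)) ∘ pd i f) x := by
  ext x v
  conv_lhs => rw [eq_sum_e4 v]
  simp [pd, e4, EuclideanSpace.inner_single_left, mul_comm]

lemma norm_iteratedFDeriv_succ_le {f : E4 → ℝ} (hf : ContDiff ℝ ∞ f) (k : ℕ) (x : E4) :
    ‖iteratedFDeriv ℝ (k + 1) f x‖ ≤ ∑ i, ‖iteratedFDeriv ℝ k (pd i f) x‖ := by
  have hk : (k : ℕ∞ω) ≤ ∞ := by exact_mod_cast le_top
  have hc : ∀ i, ContDiffAt ℝ k (pd i f) x := fun i => ((hf.pd i).of_le hk).contDiffAt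
  rw [← norm_iteratedFDeriv_fderiv, fderiv_eq_sum_pd, iteratedFDeriv_fun_sum_apply fun i _ =>
    (ContinuousLinearMap.contDiff _).contDiffAt.comp x (hc i)]
  refine norm_sum_le_of_le _ fun i _ => ?_
  refine (ContinuousLinearMap.norm_iteratedFDeriv_comp_left _ (hc i) le_rfl).trans ?_
  simp [e4]

lemma norm_iteratedFDeriv_mvFun_le {n : ℕ} (hn : 1 ≤ n) (k : ℕ) {x : E4}
    (hx : ‖x‖ ≤ 1 + 1 / (n : ℝ) ^ 2) {P : MvPolynomial (Fin 4) ℝ} (hP : P.totalDegree ≤ n)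
    {M : ℝ} (hM : 0 < M) (hb : ∀ x, ‖x‖ ≤ 1 → |mvFun P x| ≤ M) :
    ‖iteratedFDeriv ℝ k (mvFun P) x‖ ≤ cosh 2 * (8 * cosh 2 * (n : ℝ) ^ 4) ^ k * M := by
  have hn' : (1 : ℝ) ≤ n := by exact_mod_cast hn
  induction k generalizing P M with
  | zero => simpa using abs_mvFun_le hn hP hM hb hx
  | succ k ih =>
    refine (norm_iteratedFDeriv_succ_le (contDiff_mvFun P) k x).trans ?_
    have hpos : 0 < 2 * cosh 2 * (n : ℝ) ^ 4 * M := by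
      have := Real.cosh_pos 2
      positivity
    have : ∀ i, ‖iteratedFDeriv ℝ k (pd i (mvFun P)) x‖ ≤
        cosh 2 * (8 * cosh 2 * (n : ℝ) ^ 4) ^ k * (2 * cosh 2 * (n : ℝ) ^ 4 * M) := fun i => by
      rw [pd_mvFun]
      refine ih (totalDegree_pderiv_le i P (hP.trans n.le_succ)) hpos fun y hy => ?_
      rw [← pd_mvFun]
      exact abs_pd_mvFun_le hn hP hM hb i hy
    refine (Finset.sum_le_sum fun i _ => this i).trans (le_of_eq ?_)
    simp
    ring

open MeasureTheory UnitAddTorus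

/-- The function on the torus obtained by composing `Ψ` with the embedding into `ℂ⁴`. -/
def torusFun (Ψ : (Fin 4 → ℂ) → ℂ) (t : UnitAddTorus (Fin 4)) : ℂ :=
  Ψ fun i => (AddCircle.toCircle (t i) : ℂ)

/-- The derivative of `Ψ` along the `i`-th unit-period rotation of `ℂ⁴`. -/
def angD (i : Fin 4) (Ψ : (Fin 4 → ℂ) → ℂ) (z : Fin 4 → ℂ) : ℂ :=
  fderiv ℝ Ψ z (Pi.single i (2 * π * Complex.I * z i))

/-- Normalized Haar measure on the torus. -/
abbrev torusHaar : Measure (UnitAddTorus (Fin 4)) := Measure.pi fun _ => AddCircle.haarAddCircle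

lemma mFourierCoeff_eq_torusHaar (f : UnitAddTorus (Fin 4) → ℂ) (n : Fin 4 → ℤ) :
    mFourierCoeff f n = ∫ t, mFourier (-n) t • f t ∂torusHaar := rfl

lemma ContDiff.angD {Ψ : (Fin 4 → ℂ) → ℂ} (hΨ : ContDiff ℝ ∞ Ψ) (i : Fin 4) :
    ContDiff ℝ ∞ (angD i Ψ) := by
  refine (hΨ.fderiv_right (m := ∞) (by simp)).clm_apply ?_
  exact (ContinuousLinearMap.single ℝ (fun _ : Fin 4 => ℂ) i).contDiff.comp
    (contDiff_const.mul (contDiff_apply ℝ ℂ i))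

lemma continuous_torusFun {Ψ : (Fin 4 → ℂ) → ℂ} (hΨ : ContDiff ℝ ∞ Ψ) :
    Continuous (torusFun Ψ) := by
  refine hΨ.continuous.comp (continuous_pi fun i => ?_)
  exact continuous_subtype_val.comp (AddCircle.continuous_toCircle.comp (continuous_apply i))

lemma mFourierCoeff_translate (f : UnitAddTorus (Fin 4) → ℂ) (n : Fin 4 → ℤ)
    (s : UnitAddTorus (Fin 4)) :
    mFourierCoeff (fun t => f (t + s)) n = mFourier n s * mFourierCoeff f n := by
  rw [mFourierCoeff_eq_torusHaar, mFourierCoeff_eq_torusHaar, ← integral_const_mul,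
    ← integral_add_right_eq_self (μ := torusHaar) (fun t => mFourier n s * _) s]
  refine integral_congr_ae (.of_forall fun t => ?_)
  have h1 : mFourier (-n) (t + s) = mFourier (-n) t * mFourier (-n) s := by
    simp [mFourier, fourier_apply, AddCircle.toCircle_add, smul_add, Finset.prod_mul_distrib]
  have h2 : mFourier n s * mFourier (-n) s = 1 := by
    rw [← mFourier_add, add_neg_cancel, mFourier_zero, ContinuousMap.one_apply]
  simp only [smul_eq_mul, h1]
  linear_combination (-mFourier (-n) t * f (t + s)) * h2

/-- The point of the torus with `i`-th coordinate `h` and other coordinates `0`. -/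
def torusShift (i : Fin 4) (h : ℝ) : UnitAddTorus (Fin 4) := Pi.single i (h : UnitAddCircle)

lemma mFourier_torusShift (n : Fin 4 → ℤ) (i : Fin 4) (h : ℝ) :
    mFourier n (torusShift i h) = Complex.exp (2 * π * Complex.I * n i * h) := by
  rw [mFourier, ContinuousMap.coe_mk, Finset.prod_eq_single i]
  · rw [torusShift, Pi.single_eq_same, fourier_coe_apply]
    simp
  · intro j _ hj
    rw [torusShift, Pi.single_eq_of_ne hj, fourier_eval_zero]
  · simp

lemma hasDerivAt_torusFun {Ψ : (Fin 4 → ℂ) → ℂ} (hΨ : ContDiff ℝ ∞ Ψ) (i : Fin 4)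
    (t : UnitAddTorus (Fin 4)) (h : ℝ) :
    HasDerivAt (fun h : ℝ => torusFun Ψ (t + torusShift i h))
      (torusFun (angD i Ψ) (t + torusShift i h)) h := by
  have key : HasDerivAt (fun h : ℝ => fun j =>
      (AddCircle.toCircle (t j + torusShift i h j) : ℂ))
      (Pi.single i (2 * π * Complex.I * AddCircle.toCircle (t i + torusShift i h i))) h := by
    rw [hasDerivAt_pi]
    intro j
    by_cases hj : j = i
    · subst hj
      simp only [torusShift, Pi.single_eq_same, AddCircle.toCircle_add,
        AddCircle.toCircle_apply_mk, Circle.coe_mul, Circle.coe_exp]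
      have h1 : HasDerivAt (fun h : ℝ => (((2 * π / 1 * h : ℝ) : ℂ) * Complex.I))
          (2 * π * Complex.I) h := by
        have := ((hasDerivAt_id h).const_mul (2 * π / 1)).ofReal_comp.mul_const Complex.I
        simpa using this
      refine (h1.cexp.const_mul _).congr_deriv ?_
      ring
    · simp only [torusShift, Pi.single_eq_of_ne hj, add_zero]
      exact hasDerivAt_const _ _
  exact ((hΨ.differentiable (by simp)).differentiableAt.hasFDerivAt).comp_hasDerivAt h key

lemma exists_norm_torusFun_le {Ψ : (Fin 4 → ℂ) → ℂ} (hΨ : ContDiff ℝ ∞ Ψ) :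
    ∃ C, ∀ t, ‖torusFun Ψ t‖ ≤ C := by
  obtain ⟨C, hC⟩ := isCompact_univ.exists_bound_of_continuousOn (continuous_torusFun hΨ).continuousOn
  exact ⟨C, fun t => hC t (mem_univ t)⟩

lemma norm_mFourier_smul_le (n : Fin 4 → ℤ) (t : UnitAddTorus (Fin 4)) (z : ℂ) :
    ‖mFourier n t • z‖ ≤ ‖z‖ := by
  have := (mFourier n).norm_coe_le_norm t
  rw [mFourier_norm] at this
  rw [norm_smul]
  exact mul_le_of_le_one_left (norm_nonneg z) this

lemma mFourierCoeff_of_hasDerivAt {f f' : UnitAddTorus (Fin 4) → ℂ} (hf : Continuous f)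
    (hf' : Continuous f') {C : ℝ} (hC : ∀ t, ‖f' t‖ ≤ C) {i : Fin 4}
    (hd : ∀ t, ∀ h : ℝ,
      HasDerivAt (fun h : ℝ => f (t + torusShift i h)) (f' (t + torusShift i h)) h)
    (n : Fin 4 → ℤ) : mFourierCoeff f' n = 2 * π * Complex.I * n i * mFourierCoeff f n := by
  have hcont : ∀ {g : UnitAddTorus (Fin 4) → ℂ}, Continuous g → ∀ h : ℝ, Continuous fun t =>
      mFourier (-n) t • g (t + torusShift i h) := fun hg h =>
    (mFourier (-n)).continuous.smul (hg.comp (continuous_add_const _))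
  have h1 := (hasDerivAt_integral_of_dominated_loc_of_deriv_le (μ := torusHaar)
    (F := fun (h : ℝ) t => mFourier (-n) t • f (t + torusShift i h))
    (F' := fun (h : ℝ) t => mFourier (-n) t • f' (t + torusShift i h))
    (x₀ := 0) (s := univ) (bound := fun _ => C) Filter.univ_mem
    (.of_forall fun h => (hcont hf h).aestronglyMeasurable)
    ((hcont hf 0).integrable_of_hasCompactSupport (.of_compactSpace _))
    (hcont hf' 0).aestronglyMeasurable
    (.of_forall fun t h _ => (norm_mFourier_smul_le _ _ _).trans (hC _))
    (integrable_const C)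
    (.of_forall fun t h _ => (hd t h).const_mul (mFourier (-n) t))).2
  have h2 : (fun h : ℝ => ∫ t, mFourier (-n) t • f (t + torusShift i h) ∂torusHaar) =
      fun h : ℝ => Complex.exp (2 * π * Complex.I * n i * h) * mFourierCoeff f n := by
    ext h
    rw [← mFourier_torusShift, ← mFourierCoeff_translate, mFourierCoeff_eq_torusHaar]
  rw [h2] at h1
  have h3 : HasDerivAt (fun h : ℝ => Complex.exp (2 * π * Complex.I * n i * h) *
      mFourierCoeff f n) (2 * π * Complex.I * n i * mFourierCoeff f n) 0 := by
    have h4 := ((Complex.ofRealCLM.hasDerivAt (x := (0 : ℝ))).const_mul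
      (2 * π * Complex.I * n i)).cexp.mul_const (mFourierCoeff f n)
    simpa using h4
  have h5 : torusShift i 0 = 0 := by simp [torusShift]
  rw [h3.unique h1, mFourierCoeff_eq_torusHaar]
  simp only [h5, add_zero]

lemma mFourierCoeff_angD {Ψ : (Fin 4 → ℂ) → ℂ} (hΨ : ContDiff ℝ ∞ Ψ) (i : Fin 4) (n : Fin 4 → ℤ) :
    mFourierCoeff (torusFun (angD i Ψ)) n =
      2 * π * Complex.I * n i * mFourierCoeff (torusFun Ψ) n := by
  obtain ⟨C, hC⟩ := exists_norm_torusFun_le (hΨ.angD i)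
  exact mFourierCoeff_of_hasDerivAt (continuous_torusFun hΨ) (continuous_torusFun (hΨ.angD i)) hC
    (hasDerivAt_torusFun hΨ i) n

lemma norm_mFourierCoeff_le {f : UnitAddTorus (Fin 4) → ℂ} {C : ℝ} (hC : ∀ t, ‖f t‖ ≤ C)
    (n : Fin 4 → ℤ) : ‖mFourierCoeff f n‖ ≤ C := by
  rw [mFourierCoeff_eq_torusHaar]
  refine (norm_integral_le_of_norm_le_const (C := C) (.of_forall fun t => ?_)).trans (by simp)
  exact (norm_mFourier_smul_le _ _ _).trans (hC t)

lemma exists_norm_mFourierCoeff_mul_le {Ψ : (Fin 4 → ℂ) → ℂ} (hΨ : ContDiff ℝ ∞ Ψ)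
    (i : Fin 4) (m : ℕ) :
    ∃ C, ∀ n : Fin 4 → ℤ, ‖mFourierCoeff (torusFun Ψ) n‖ * |(n i : ℝ)| ^ m ≤ C := by
  induction m generalizing Ψ with
  | zero =>
    obtain ⟨C, hC⟩ := exists_norm_torusFun_le hΨ
    exact ⟨C, fun n => by simpa using norm_mFourierCoeff_le hC n⟩
  | succ m ih =>
    obtain ⟨C, hC⟩ := ih (hΨ.angD i)
    refine ⟨C, fun n => (le_trans ?_ (hC n))⟩
    rw [mFourierCoeff_angD hΨ, pow_succ']
    have h2 : (1 : ℝ) ≤ 2 * π := by linarith [Real.pi_gt_three]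
    have : ‖2 * π * Complex.I * n i * mFourierCoeff (torusFun Ψ) n‖ =
        2 * π * (|(n i : ℝ)| * ‖mFourierCoeff (torusFun Ψ) n‖) := by
      simp [abs_of_pos Real.pi_pos]
      ring
    rw [this]
    have h3 : 0 ≤ ‖mFourierCoeff (torusFun Ψ) n‖ * (|(n i : ℝ)| * |(n i : ℝ)| ^ m) := by positivity
    nlinarith

/-- The `ℓ¹` size of a frequency. -/
def freq (n : Fin 4 → ℤ) : ℕ := ∑ i, (n i).natAbs

lemma exists_norm_mFourierCoeff_mul_freq_le {Ψ : (Fin 4 → ℂ) → ℂ} (hΨ : ContDiff ℝ ∞ Ψ) (m : ℕ) :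
    ∃ C, ∀ n : Fin 4 → ℤ,
      ‖mFourierCoeff (torusFun Ψ) n‖ * ((1 : ℝ) + freq n) ^ m ≤ C := by
  choose C hC using fun i => exists_norm_mFourierCoeff_mul_le hΨ i m
  obtain ⟨C₀, hC₀⟩ := exists_norm_mFourierCoeff_mul_le hΨ 0 0
  refine ⟨5 ^ m * (C₀ + ∑ i, C i), fun n => ?_⟩
  set c := ‖mFourierCoeff (torusFun Ψ) n‖
  have hc : 0 ≤ c := norm_nonneg _
  obtain ⟨i, -, hi⟩ := Finset.exists_max_image Finset.univ (fun i => (n i).natAbs) ⟨0, by simp⟩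
  have h1 : (1 : ℝ) + freq n ≤ 5 * max 1 |(n i : ℝ)| := by
    have : freq n ≤ 4 * (n i).natAbs := by
      simpa [freq] using Finset.sum_le_card_nsmul Finset.univ _ _ hi
    have h' : (freq n : ℝ) ≤ 4 * |(n i : ℝ)| := by
      rw [← Int.cast_abs, Int.abs_eq_natAbs]
      exact_mod_cast this
    linarith [le_max_left 1 |(n i : ℝ)|, le_max_right 1 |(n i : ℝ)|]
  have h2 : (max 1 |(n i : ℝ)|) ^ m ≤ 1 + |(n i : ℝ)| ^ m := by
    rcases max_choice 1 |(n i : ℝ)| with h | h <;> rw [h]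
    · rw [one_pow]; linarith [pow_nonneg (abs_nonneg (n i : ℝ)) m]
    · linarith
  have h3 : c * 1 ≤ C₀ := by simpa using hC₀ n
  have h4 : c * |(n i : ℝ)| ^ m ≤ ∑ i, C i :=
    (hC i n).trans (Finset.single_le_sum (f := C) (fun j _ => le_trans (by positivity) (hC j n))
      (Finset.mem_univ i))
  calc c * (1 + freq n) ^ m ≤ c * (5 * max 1 |(n i : ℝ)|) ^ m := by gcongr
    _ = 5 ^ m * (c * (max 1 |(n i : ℝ)|) ^ m) := by rw [mul_pow]; ring
    _ ≤ 5 ^ m * (c * (1 + |(n i : ℝ)| ^ m)) := by gcongr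
    _ ≤ _ := by gcongr; linarith

lemma summable_pi_prod {ι : Type*} {f : ι → ℝ} (hf : Summable f) (hf0 : ∀ k, 0 ≤ f k) :
    Summable fun n : Fin 4 → ι => ∏ i, f (n i) := by
  classical
  refine summable_of_sum_le (c := ∏ _i : Fin 4, ∑' k, f k)
    (fun n => Finset.prod_nonneg fun i _ => hf0 _) fun s => ?_
  have hs : s ⊆ Fintype.piFinset fun i => s.image (· i) := fun n hn =>
    Fintype.mem_piFinset.2 fun i => Finset.mem_image_of_mem _ hn
  refine (Finset.sum_le_sum_of_subset_of_nonneg hs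
    fun n _ _ => Finset.prod_nonneg fun i _ => hf0 _).trans ?_
  rw [← Finset.prod_univ_sum (fun i => s.image (· i)) fun _ k => f k]
  exact Finset.prod_le_prod (fun i _ => Finset.sum_nonneg fun k _ => hf0 k)
    fun i _ => hf.sum_le_tsum _ fun k _ => hf0 k

lemma summable_freq_pow_inv : Summable fun n : Fin 4 → ℤ => (((1 : ℝ) + freq n) ^ 8)⁻¹ := by
  have h1 : Summable fun k : ℤ => (((1 : ℝ) + k.natAbs) ^ 2)⁻¹ := by
    refine Summable.of_norm_bounded_eventually (Real.summable_one_div_int_pow (p := 2).2 one_lt_two) ?_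
    rw [Filter.eventually_cofinite]
    refine (finite_singleton (0 : ℤ)).subset fun k hk => ?_
    by_contra h
    refine hk ?_
    have h0 : (0 : ℝ) < |(k : ℝ)| := abs_pos.2 (by exact_mod_cast h)
    rw [Real.norm_of_nonneg (by positivity), Nat.cast_natAbs, Int.cast_abs, ← sq_abs (k : ℝ), one_div]
    gcongr
    linarith
  refine (summable_pi_prod h1 fun k => by positivity).of_nonneg_of_le (fun n => by positivity)
    fun n => ?_
  rw [Finset.prod_inv_distrib]
  refine inv_anti₀ (Finset.prod_pos fun i _ => by positivity) ?_
  calc ∏ i, ((1 : ℝ) + (n i).natAbs) ^ 2 ≤ ∏ _i : Fin 4, ((1 : ℝ) + freq n) ^ 2 := by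
        refine Finset.prod_le_prod (fun i _ => by positivity) fun i _ => ?_
        gcongr
        exact Finset.single_le_sum (f := fun i => (n i).natAbs) (fun _ _ => Nat.zero_le _)
          (Finset.mem_univ i)
    _ = _ := by simp [← pow_mul]

lemma summable_norm_mFourierCoeff_mul {Ψ : (Fin 4 → ℂ) → ℂ} (hΨ : ContDiff ℝ ∞ Ψ) (m : ℕ) :
    Summable fun n => ‖mFourierCoeff (torusFun Ψ) n‖ * ((1 : ℝ) + freq n) ^ m := by
  obtain ⟨C, hC⟩ := exists_norm_mFourierCoeff_mul_freq_le hΨ (m + 8)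
  refine (summable_freq_pow_inv.mul_left C).of_nonneg_of_le (fun n => by positivity) fun n => ?_
  rw [← div_eq_mul_inv, le_div_iff₀ (by positivity), mul_assoc, ← pow_add]
  exact hC n

open Classical in
lemma hasSum_mFourier_mixed {F : UnitAddTorus (Fin 4) → ℂ} {c : (Fin 4 → ℤ) → ℂ}
    (hF : ∀ t, HasSum (fun n => c n * mFourier n t) (F t))
    (hsymm : ∀ t i, F (Function.update t i (-(t i))) = F t) (s : Finset (Fin 4))
    (t : UnitAddTorus (Fin 4)) :
    HasSum (fun n => c n * ∏ i, if i ∈ s then (fourier (n i) (t i) + fourier (n i) (-(t i))) / 2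
      else fourier (n i) (t i)) (F t) := by
  induction s using Finset.induction_on generalizing t with
  | empty => simpa [mFourier] using hF t
  | insert i s hi ih =>
    have h := ((ih t).add (ih (Function.update t i (-(t i))))).div_const 2
    rw [hsymm, add_self_div_two] at h
    refine h.congr_fun fun n => ?_
    simp only [← Finset.mul_prod_erase Finset.univ _ (Finset.mem_univ i), hi, if_false,
      Finset.mem_insert_self, if_true, Function.update_self]
    have h1 : ∀ u v : UnitAddTorus (Fin 4), ∀ s s' : Finset (Fin 4), (∀ j ≠ i, u j = v j) →
        (∀ j ≠ i, j ∈ s ↔ j ∈ s') →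
        (∏ j ∈ Finset.univ.erase i, if j ∈ s then (fourier (n j) (u j) + fourier (n j) (-(u j))) / 2
          else (fourier (n j) (u j) : ℂ)) = ∏ j ∈ Finset.univ.erase i,
          if j ∈ s' then (fourier (n j) (v j) + fourier (n j) (-(v j))) / 2
          else fourier (n j) (v j) := fun u v s s' huv hss =>
      Finset.prod_congr rfl fun j hj => by
        have hj' := Finset.ne_of_mem_erase hj
        simp only [huv j hj', hss j hj']
    rw [h1 (Function.update t i (-(t i))) t s s (fun j hj => Function.update_of_ne hj _ _)
      fun _ _ => Iff.rfl, h1 t t (insert i s) s (fun _ _ => rfl)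
      fun j hj => by simp [hj]]
    ring

lemma fourier_add_fourier_neg (k : ℤ) (θ : ℝ) :
    ((fourier k ((θ / (2 * π) : ℝ) : UnitAddCircle) : ℂ) +
      fourier k (-((θ / (2 * π) : ℝ) : UnitAddCircle))) / 2 =
      ((Polynomial.Chebyshev.T ℝ k).eval (cos θ) : ℝ) := by
  rw [Polynomial.Chebyshev.T_real_cos, ← AddCircle.coe_neg, fourier_coe_apply, fourier_coe_apply,
    Complex.ofReal_cos, Complex.cos]
  have hπ : (π : ℂ) ≠ 0 := by exact_mod_cast Real.pi_ne_zero
  congr 3 <;> push_cast <;> field_simp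

lemma exists_hasSum_chebyshev {Φ : E4 → ℝ} (hΦ : ContDiff ℝ ∞ Φ) :
    ∃ a : (Fin 4 → ℤ) → ℝ, (∀ m : ℕ, Summable fun n => |a n| * ((1 : ℝ) + freq n) ^ m) ∧
      ∀ x : E4, (∀ i, |x i| ≤ 1) →
        HasSum (fun n => a n * ∏ i, (Polynomial.Chebyshev.T ℝ (n i)).eval (x i)) (Φ x) := by
  set Ψ : (Fin 4 → ℂ) → ℂ := fun z => (Φ (WithLp.toLp 2 fun i => (z i).re) : ℂ) with hΨdef
  have hΨ : ContDiff ℝ ∞ Ψ := by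
    refine Complex.ofRealCLM.contDiff.comp (hΦ.comp ?_)
    refine (PiLp.contDiff_toLp (p := 2)).comp (contDiff_pi.2 fun i => ?_)
    exact Complex.reCLM.contDiff.comp (contDiff_apply ℝ ℂ i)
  set c := mFourierCoeff (torusFun Ψ)
  have hsum : ∀ m : ℕ, Summable fun n => ‖c n‖ * ((1 : ℝ) + freq n) ^ m :=
    summable_norm_mFourierCoeff_mul hΨ
  have hF : ∀ t, HasSum (fun n => c n * mFourier n t) (torusFun Ψ t) := fun t => by
    have h0 : Summable (mFourierCoeff (⟨torusFun Ψ, continuous_torusFun hΨ⟩ : C(_, ℂ))) :=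
      Summable.of_norm (by simpa using hsum 0)
    simpa using! hasSum_mFourier_series_apply_of_summable h0 t
  have hsymm : ∀ t i, torusFun Ψ (Function.update t i (-(t i))) = torusFun Ψ t := fun t i => by
    simp only [torusFun, hΨdef]
    congr 3
    ext j
    rcases eq_or_ne j i with rfl | hj
    · simp [AddCircle.toCircle_neg]
    · simp [hj]
  refine ⟨fun n => (c n).re, fun m => (hsum m).of_nonneg_of_le (fun n => by positivity)
    fun n => by gcongr; exact Complex.abs_re_le_norm _, fun x hx => ?_⟩
  have h := Complex.hasSum_re (hasSum_mFourier_mixed hF hsymm Finset.univ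
    fun i => ((arccos (x i) / (2 * π) : ℝ) : UnitAddCircle))
  have hval : torusFun Ψ (fun i => ((arccos (x i) / (2 * π) : ℝ) : UnitAddCircle)) = Φ x := by
    simp only [torusFun, hΨdef]
    congr 2
    ext i
    rw [PiLp.toLp_apply, AddCircle.toCircle_apply_mk, Circle.coe_exp, Complex.exp_ofReal_mul_I_re,
      div_one, mul_div_cancel₀ _ (by positivity),
      Real.cos_arccos (abs_le.1 (hx i)).1 (abs_le.1 (hx i)).2]
  rw [hval, Complex.ofReal_re] at h
  refine h.congr_fun fun n => ?_
  simp only [Finset.mem_univ, if_true, fourier_add_fourier_neg,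
    fun i => Real.cos_arccos (abs_le.1 (hx i)).1 (abs_le.1 (hx i)).2]
  rw [← Complex.ofReal_prod, Complex.re_mul_ofReal]

open Polynomial.Chebyshev in
lemma exists_harmonic_chebyshev (n : Fin 4 → ℤ) :
    ∃ Q : MvPolynomial (Fin 4) ℝ, Q.totalDegree ≤ freq n + 2 ∧ (∀ x, lap (mvFun Q) x = 0) ∧
      (∀ x, ‖x‖ = 1 → mvFun Q x = ∏ i, (T ℝ (n i)).eval (x i)) ∧
      ∀ x, ‖x‖ ≤ 1 → |mvFun Q x| ≤ 1 := by
  set P : MvPolynomial (Fin 4) ℝ := ∏ i, Polynomial.aeval (MvPolynomial.X i) (T ℝ (n i)) with hP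
  have hdeg : P.totalDegree ≤ freq n := by
    refine (MvPolynomial.totalDegree_finsetProd _ _).trans (Finset.sum_le_sum fun i _ => ?_)
    rw [Polynomial.aeval_eq_sum_range]
    refine (MvPolynomial.totalDegree_finsetSum _ _).trans (Finset.sup_le fun k hk => ?_)
    refine (MvPolynomial.totalDegree_smul_le _ _).trans ?_
    rw [MvPolynomial.totalDegree_X_pow, ← natDegree_T ℝ (n i)]
    exact Nat.lt_succ_iff.1 (Finset.mem_range.1 hk)
  have heval : ∀ x, mvFun P x = ∏ i, (T ℝ (n i)).eval (x i) := fun x => by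
    simp only [mvFun, hP, map_prod]
    refine Finset.prod_congr rfl fun i _ => ?_
    rw [Polynomial.aeval_def, Polynomial.hom_eval₂, MvPolynomial.eval_X,
      Polynomial.eval, show (MvPolynomial.eval fun i => x i).comp
        (algebraMap ℝ (MvPolynomial (Fin 4) ℝ)) = RingHom.id ℝ from RingHom.ext fun r => by simp]
  obtain ⟨Q, hQ, hlap, hbd⟩ := exists_harmonic_mvFun P (hdeg.trans (Nat.le_add_right _ 2))
  refine ⟨Q, hQ, hlap, fun x hx => (hbd x hx).trans (heval x), fun x hx => ?_⟩
  refine abs_le_of_lap_eq_zero (contDiff_mvFun Q) (fun x _ => hlap x) (fun y hy => ?_) hx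
  rw [hbd y hy, heval, Finset.abs_prod]
  refine Finset.prod_le_one (fun i _ => abs_nonneg _) fun i _ => abs_eval_T_real_le_one _ ?_
  rw [← hy, ← Real.norm_eq_abs]
  exact PiLp.norm_apply_le y i

/-- A smooth cutoff equal to `1` on the unit ball and supported in `‖x‖² ≤ 1 + 1 / n²`. -/
def cutoff (n : ℕ) : E4 → ℝ := Real.smoothTransition ∘ fun x => 1 + (n : ℝ) ^ 2 * rho x

lemma contDiff_cutoff (n : ℕ) : ContDiff ℝ ∞ (cutoff n) :=
  Real.smoothTransition.contDiff.comp (contDiff_const.add (contDiff_const.mul contDiff_rho))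

lemma cutoff_eq_one {n : ℕ} {x : E4} (hx : ‖x‖ ≤ 1) : cutoff n x = 1 := by
  refine Real.smoothTransition.one_of_one_le ?_
  have : 0 ≤ rho x := by rw [rho]; nlinarith [norm_nonneg x]
  nlinarith [mul_nonneg (sq_nonneg (n : ℝ)) this]

lemma exists_norm_iteratedFDeriv_smoothTransition_le (k : ℕ) :
    ∃ C, ∀ s, 0 ≤ s → ‖iteratedFDeriv ℝ k Real.smoothTransition s‖ ≤ C := by
  have hc : ContDiff ℝ ∞ Real.smoothTransition := Real.smoothTransition.contDiff
  obtain ⟨C, hC⟩ := (isCompact_Icc (a := (0 : ℝ)) (b := 1)).exists_bound_of_continuousOn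
    (hc.continuous_iteratedFDeriv (m := k) (by exact_mod_cast le_top)).continuousOn
  refine ⟨max C 1, fun s hs => ?_⟩
  rcases le_or_gt s 1 with h | h
  · exact (hC s ⟨hs, h⟩).trans (le_max_left _ _)
  · have : Real.smoothTransition =ᶠ[𝓝 s] fun _ => 1 := by
      filter_upwards [lt_mem_nhds h] with t ht using Real.smoothTransition.one_of_one_le ht.le
    rw [(this.iteratedFDeriv ℝ k).eq_of_nhds]
    refine le_trans ?_ (le_max_right _ _)
    rcases eq_or_ne k 0 with rfl | hk
    · simp
    · simp [iteratedFDeriv_const_of_ne hk]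

lemma exists_bound_forall_le {p : ℕ → ℝ → Prop} (hp : ∀ k, ∃ C, p k C)
    (hmono : ∀ k C C', C ≤ C' → p k C → p k C') (K : ℕ) : ∃ C, 1 ≤ C ∧ ∀ k ≤ K, p k C := by
  choose c hc using hp
  refine ⟨1 + ∑ k ∈ Finset.range (K + 1), |c k|, ?_, fun k hk => hmono k _ _ ?_ (hc k)⟩
  · linarith [Finset.sum_nonneg fun k (_ : k ∈ Finset.range (K + 1)) => abs_nonneg (c k)]
  · have := Finset.single_le_sum (f := fun k => |c k|) (fun k _ => abs_nonneg (c k))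
      (Finset.mem_range.2 (Nat.lt_succ_iff.2 hk))
    linarith [le_abs_self (c k)]

lemma exists_norm_iteratedFDeriv_cutoff_le (K : ℕ) :
    ∃ C, ∀ n : ℕ, 1 ≤ n → ∀ x : E4, ‖x‖ ≤ 2 → 0 ≤ 1 + (n : ℝ) ^ 2 * rho x → ∀ k ≤ K,
      ‖iteratedFDeriv ℝ k (cutoff n) x‖ ≤ C * (n : ℝ) ^ (2 * K) := by
  obtain ⟨A, hA1, hA⟩ := exists_bound_forall_le exists_norm_iteratedFDeriv_smoothTransition_le
    (fun k C C' h hC s hs => (hC s hs).trans h) K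
  obtain ⟨B, hB1, hB⟩ := exists_bound_forall_le
    (p := fun k C => ∀ x : E4, ‖x‖ ≤ 2 → ‖iteratedFDeriv ℝ k rho x‖ ≤ C)
    (fun k => by
      obtain ⟨C, hC⟩ := (isCompact_closedBall (0 : E4) 2).exists_bound_of_continuousOn
        (contDiff_rho.continuous_iteratedFDeriv (m := k) (by exact_mod_cast le_top)).continuousOn
      exact ⟨C, fun x hx => hC x (by simpa using hx)⟩)
    (fun k C C' h hC s hs => (hC s hs).trans h) K
  refine ⟨K.factorial * A * B ^ K, fun n hn x hx hx0 k hk => ?_⟩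
  have hn' : (1 : ℝ) ≤ n := by exact_mod_cast hn
  have hn2 : (1 : ℝ) ≤ (n : ℝ) ^ 2 * B := one_le_mul_of_one_le_of_one_le (one_le_pow₀ hn') hB1
  have hk' : (k : ℕ∞ω) ≤ ∞ := by exact_mod_cast le_top
  have h := norm_iteratedFDeriv_comp_le (g := Real.smoothTransition)
    (f := fun x => 1 + (n : ℝ) ^ 2 * rho x) (N := ∞) Real.smoothTransition.contDiff
    (contDiff_const.add (contDiff_const.mul contDiff_rho)) hk' x
    (C := A) (D := (n : ℝ) ^ 2 * B) (fun i hi => hA i (hi.trans hk) _ hx0) fun i hi hik => by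
      refine le_trans ?_ (le_self_pow₀ hn2 (by omega))
      have hi' : (i : ℕ∞ω) ≤ ∞ := by exact_mod_cast le_top
      have hr : ContDiffAt ℝ i rho x := (contDiff_rho.of_le hi').contDiffAt
      rw [fun_iteratedFDeriv_add_apply contDiffAt_const (contDiffAt_const.mul hr),
        iteratedFDeriv_const_of_ne (by omega), Pi.zero_apply, zero_add]
      change ‖iteratedFDeriv ℝ i (fun y => (n : ℝ) ^ 2 • rho y) x‖ ≤ _
      rw [iteratedFDeriv_const_smul_apply' hr, norm_smul, Real.norm_of_nonneg (by positivity)]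
      gcongr
      exact hB i (hik.trans hk) x hx
  refine h.trans ?_
  calc (k.factorial : ℝ) * A * ((n : ℝ) ^ 2 * B) ^ k
      ≤ K.factorial * A * ((n : ℝ) ^ 2 * B) ^ K := by
        gcongr
    _ = _ := by rw [mul_pow, ← pow_mul]; ring

lemma exists_norm_iteratedFDeriv_cutoff_mul_le (K : ℕ) :
    ∃ C, ∀ n : ℕ, 1 ≤ n → ∀ P : MvPolynomial (Fin 4) ℝ, P.totalDegree ≤ n →
      (∀ x, ‖x‖ ≤ 1 → |mvFun P x| ≤ 1) → ∀ x : E4,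
      ‖iteratedFDeriv ℝ K (fun y => cutoff n y * mvFun P y) x‖ ≤ C * (n : ℝ) ^ (6 * K) := by
  obtain ⟨A, hA⟩ := exists_norm_iteratedFDeriv_cutoff_le K
  have hA0 : 0 ≤ A := by
    have := (norm_nonneg _).trans (hA 1 le_rfl 0 (by simp) (by norm_num [rho]) 0 (Nat.zero_le _))
    simpa using this
  have hc := Real.one_le_cosh 2
  refine ⟨2 ^ K * A * (cosh 2 * (8 * cosh 2) ^ K), fun n hn P hP hb x => ?_⟩
  have hn' : (1 : ℝ) ≤ n := by exact_mod_cast hn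
  rcases lt_or_ge (1 + (n : ℝ) ^ 2 * rho x) 0 with h | h
  · have h0 : (fun y => cutoff n y * mvFun P y) =ᶠ[𝓝 x] fun _ => 0 := by
      have hcont : Continuous fun x => 1 + (n : ℝ) ^ 2 * rho x :=
        continuous_const.add (continuous_const.mul contDiff_rho.continuous)
      filter_upwards [hcont.continuousAt.eventually (gt_mem_nhds h)] with y hy
      rw [cutoff, Function.comp_apply, Real.smoothTransition.zero_of_nonpos hy.le, zero_mul]
    rw [(h0.iteratedFDeriv ℝ K).eq_of_nhds, iteratedFDeriv_fun_zero, Pi.zero_apply, norm_zero]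
    positivity
  have h2 : ‖x‖ ^ 2 ≤ 1 + 1 / (n : ℝ) ^ 2 := by
    rw [← sub_le_iff_le_add', le_div_iff₀ (by positivity)]
    rw [rho] at h
    linarith
  have h3 : ‖x‖ ≤ 1 + 1 / (n : ℝ) ^ 2 := by
    have h4 : (0 : ℝ) ≤ 1 / (n : ℝ) ^ 2 := by positivity
    nlinarith [norm_nonneg x]
  have h5 : ‖x‖ ≤ 2 := by
    have h4 : 1 / (n : ℝ) ^ 2 ≤ 1 := div_le_one_of_le₀ (one_le_pow₀ hn') (by positivity)
    linarith
  refine (norm_iteratedFDeriv_mul_le (contDiff_cutoff n) (contDiff_mvFun P) x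
    (by exact_mod_cast le_top)).trans ?_
  have hB : (1 : ℝ) ≤ 8 * cosh 2 * (n : ℝ) ^ 4 :=
    one_le_mul_of_one_le_of_one_le (by linarith) (one_le_pow₀ hn')
  calc _ ≤ ∑ i ∈ Finset.range (K + 1), (K.choose i : ℝ) * (A * (n : ℝ) ^ (2 * K)) *
        (cosh 2 * (8 * cosh 2 * (n : ℝ) ^ 4) ^ K) := by
        refine Finset.sum_le_sum fun i hi => ?_
        gcongr
        · exact hA n hn x h5 h i (Nat.lt_succ_iff.1 (Finset.mem_range.1 hi))
        · refine (norm_iteratedFDeriv_mvFun_le hn _ h3 hP one_pos hb).trans ?_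
          rw [mul_one]
          gcongr
          exact Nat.sub_le _ _
    _ = 2 ^ K * (A * (n : ℝ) ^ (2 * K)) * (cosh 2 * (8 * cosh 2 * (n : ℝ) ^ 4) ^ K) := by
        rw [← Finset.sum_mul, ← Finset.sum_mul]
        norm_cast
        rw [Nat.sum_range_choose]
    _ = _ := by rw [mul_pow, ← pow_mul]; ring

lemma lap_eq_iteratedFDeriv {u : E4 → ℝ} (hu : ContDiff ℝ ∞ u) (x : E4) :
    lap u x = (∑ i, ContinuousMultilinearMap.apply ℝ (fun _ : Fin 2 => E4) ℝ ![e4 i, e4 i])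
      (iteratedFDeriv ℝ 2 u x) := by
  have h : DifferentiableAt ℝ (fderiv ℝ u) x :=
    ((hu.fderiv_right (m := ∞) (by simp)).differentiable (by simp)).differentiableAt
  simp only [lap, sum_apply, ContinuousMultilinearMap.apply_apply,
    iteratedFDeriv_two_apply]
  refine Finset.sum_congr rfl fun i _ => ?_
  rw [fderiv_clm_apply h (differentiableAt_const _)]
  simp

lemma lap_congr_of_eventuallyEq {u v : E4 → ℝ} {x : E4} (h : u =ᶠ[𝓝 x] v) : lap u x = lap v x := by
  refine Finset.sum_congr rfl fun i _ => ?_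
  have : (fun y => fderiv ℝ u y (e4 i)) =ᶠ[𝓝 x] fun y => fderiv ℝ v y (e4 i) :=
    (h.fderiv (𝕜 := ℝ)).mono fun y hy => congrArg (· (e4 i)) hy
  rw [this.fderiv_eq]

lemma exists_harmonic_of_contDiff {Φ : E4 → ℝ} (hΦ : ContDiff ℝ ∞ Φ) :
    ∃ G : E4 → ℝ, ContDiff ℝ ∞ G ∧ (∀ x, ‖x‖ < 1 → lap G x = 0) ∧ ∀ x, ‖x‖ = 1 → G x = Φ x := by
  obtain ⟨a, ha, hsum⟩ := exists_hasSum_chebyshev hΦ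
  choose Q hdeg hlap hbd hle using exists_harmonic_chebyshev
  choose C hC using exists_norm_iteratedFDeriv_cutoff_mul_le
  set f : (Fin 4 → ℤ) → E4 → ℝ := fun n =>
    a n • fun y => cutoff (freq n + 2) y * mvFun (Q n) y with hf
  have hg : ∀ n, ContDiff ℝ ∞ fun y => cutoff (freq n + 2) y * mvFun (Q n) y := fun n =>
    (contDiff_cutoff _).mul (contDiff_mvFun _)
  have hfc : ∀ n, ContDiff ℝ ∞ (f n) := fun n => contDiff_const.smul (hg n)
  have hbound : ∀ (k : ℕ) (n : Fin 4 → ℤ) (x : E4), ‖iteratedFDeriv ℝ k (f n) x‖ ≤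
      C k * 2 ^ (6 * k) * (|a n| * ((1 : ℝ) + freq n) ^ (6 * k)) := fun k n x => by
    have h1 := hC k (freq n + 2) (by omega) (Q n) (hdeg n) (hle n) x
    have hC0 : 0 ≤ C k := nonneg_of_mul_nonneg_left ((norm_nonneg _).trans h1) (by positivity)
    rw [hf, iteratedFDeriv_const_smul_apply
      ((hg n).of_le (by exact_mod_cast le_top)).contDiffAt, norm_smul, Real.norm_eq_abs]
    calc _ ≤ |a n| * (C k * ((freq n + 2 : ℕ) : ℝ) ^ (6 * k)) := by gcongr
      _ ≤ |a n| * (C k * (2 * (1 + freq n)) ^ (6 * k)) := by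
        gcongr
        push_cast
        linarith [Nat.cast_nonneg (α := ℝ) (freq n)]
      _ = _ := by rw [mul_pow]; ring
  have hsm : ∀ k : ℕ, Summable fun n =>
      C k * 2 ^ (6 * k) * (|a n| * ((1 : ℝ) + freq n) ^ (6 * k)) := fun k => (ha _).mul_left _
  have hG : ContDiff ℝ ∞ fun x => ∑' n, f n x :=
    contDiff_tsum (N := ⊤) hfc (fun k _ => hsm k) fun k n x _ => hbound k n x
  refine ⟨fun x => ∑' n, f n x, hG, fun x hx => ?_, fun x hx => ?_⟩
  · have hs : Summable fun n => iteratedFDeriv ℝ 2 (f n) x :=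
      Summable.of_norm_bounded (hsm 2) fun n => hbound 2 n x
    rw [lap_eq_iteratedFDeriv hG, iteratedFDeriv_tsum_apply (N := ⊤) hfc (fun k _ => hsm k)
      (fun k n x _ => hbound k n x) (by exact_mod_cast le_top) x, ContinuousLinearMap.map_tsum _ hs]
    simp only [← lap_eq_iteratedFDeriv (hfc _)]
    rw [← tsum_zero]
    refine tsum_congr fun n => ?_
    have h1 : (fun y => cutoff (freq n + 2) y * mvFun (Q n) y) =ᶠ[𝓝 x] mvFun (Q n) := by
      filter_upwards [continuous_norm.continuousAt.eventually (gt_mem_nhds hx)] with y hy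
      rw [cutoff_eq_one hy.le, one_mul]
    rw [hf, lap_smul (hg n)]
    simp [lap_congr_of_eventuallyEq h1, hlap]
  · refine ((hsum x fun i => ?_).congr_fun fun n => ?_).tsum_eq
    · rw [← hx, ← Real.norm_eq_abs]
      exact PiLp.norm_apply_le x i
    · simp [hf, cutoff_eq_one hx.le, hbd n x hx]

lemma exists_contDiff_eq_on_sphere {φ : E4 → ℝ}
    (hφ : ContDiffOn ℝ ∞ (fun y : E4 => φ (‖y‖⁻¹ • y)) {y : E4 | y ≠ 0}) :
    ∃ Φ : E4 → ℝ, ContDiff ℝ ∞ Φ ∧ ∀ x, ‖x‖ = 1 → Φ x = φ x := by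
  refine ⟨fun y => Real.smoothTransition (4 * ‖y‖ ^ 2 - 1) * φ (‖y‖⁻¹ • y), ?_, fun x hx => ?_⟩
  · refine contDiff_iff_contDiffAt.2 fun x => ?_
    rcases eq_or_ne x 0 with rfl | hx
    · have : (fun y : E4 => Real.smoothTransition (4 * ‖y‖ ^ 2 - 1) * φ (‖y‖⁻¹ • y))
          =ᶠ[𝓝 0] fun _ => 0 := by
        filter_upwards [Metric.ball_mem_nhds (0 : E4) (half_pos one_pos)] with y hy
        rw [mem_ball_zero_iff] at hy
        rw [Real.smoothTransition.zero_of_nonpos (by nlinarith [norm_nonneg y]), zero_mul]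
      exact contDiffAt_const.congr_of_eventuallyEq this
    · have h1 : ContDiff ℝ ∞ fun y : E4 => 4 * ‖y‖ ^ 2 - 1 :=
        (contDiff_const.mul (contDiff_norm_sq ℝ)).sub contDiff_const
      exact (Real.smoothTransition.contDiff.comp h1).contDiffAt.mul
        (hφ.contDiffAt (isOpen_ne.mem_nhds hx))
  · simp only
    rw [hx, Real.smoothTransition.one_of_one_le (by norm_num), inv_one, one_smul, one_mul]

/-- Smooth data version on the ball: for smooth `φ` on `S³` (i.e. with smooth
`0`-homogeneous extension) there is a smooth solution; every solution is constant on
`S³`; with the normalization `u|_{S³} = 0` the solution is unique; and every solution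
vanishing on `S³` satisfies `sup_{B⁴} |u| ≤ sup_{S³} |φ|`. -/
theorem stmt2 (φ : E4 → ℝ)
    (hφ : ContDiffOn ℝ (⊤ : ℕ∞) (fun y : E4 => φ (‖y‖⁻¹ • y)) {y : E4 | y ≠ 0}) :
    (∃ u : E4 → ℝ, SolBall φ u) ∧
    (∀ u : E4 → ℝ, SolBall φ u → ∃ c : ℝ, ∀ x : E4, ‖x‖ = 1 → u x = c) ∧
    (∀ u₁ u₂ : E4 → ℝ, SolBall φ u₁ → SolBall φ u₂ →
      (∀ x : E4, ‖x‖ = 1 → u₁ x = 0) → (∀ x : E4, ‖x‖ = 1 → u₂ x = 0) →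
      Set.EqOn u₁ u₂ (Metric.closedBall 0 1)) ∧
    (∀ u : E4 → ℝ, SolBall φ u → (∀ x : E4, ‖x‖ = 1 → u x = 0) →
      ∀ x ∈ Metric.closedBall (0 : E4) 1,
        |u x| ≤ ⨆ y : Metric.sphere (0 : E4) 1, |φ y|) := by
  refine ⟨?_, fun u hu => ⟨biharmR u 0 / 2, fun x hx => ?_⟩, fun u₁ u₂ h₁ h₂ hz₁ hz₂ =>
    SolBall.eqOn h₁ h₂ hz₁ hz₂, fun u hu hz x hx => hu.abs_le hz (by simpa using hx)⟩
  · obtain ⟨Φ, hΦ, hΦφ⟩ := exists_contDiff_eq_on_sphere hφ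
    obtain ⟨G, hG, hlap, hGΦ⟩ := exists_harmonic_of_contDiff hΦ
    exact ⟨_, solBall_of_harmonic hG hlap fun x hx => (hGΦ x hx).trans (hΦφ x hx)⟩
  · exact eq_const_of_solBall hu.1 hu.2.1 hu.2.2.1 hx
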